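/- There exists an absolute constant c > 0 such that the following holds. Let f : ℝⁿ → ℝ be permutation invariant, and suppose |f(x) − f(y)| ≤ b‖x − y‖₂ and |f(x) − f(y)| ≤ a‖x − y‖_∞ for all x, y ∈ ℝⁿ (b, a > 0). Then for all t > 0, P( |f(G) − E f(G)| > t ) ≤ 4 exp( −c · max{ t²/b², (t/b)·√(log(n b²/a²)) } ), where G is a standard n-dimensional Gaussian vector. -/

import Mathlib

open MeasureTheory ProbabilityTheory Real

/-- The standard Gaussian measure `γₙ` on `ℝⁿ`. -/
noncomputable def stdGaussian (n : ℕ) : Measure (Fin n → ℝ) :=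
  Measure.pi fun _ => gaussianReal 0 1

/-- The Euclidean norm on `ℝⁿ`. -/
noncomputable def euclNorm {n : ℕ} (x : Fin n → ℝ) : ℝ :=
  Real.sqrt (∑ i, (x i) ^ 2)

set_option linter.unusedSectionVars false

section PermInvariantConcentration

open Set Filter Topology

/-- Bounded continuous real functions. -/
def BddCont {X : Type*} [TopologicalSpace X] (u : X → ℝ) : Prop :=
  Continuous u ∧ ∃ C, ∀ x, |u x| ≤ C

namespace BddCont

variable {X Y : Type*} [TopologicalSpace X] [TopologicalSpace Y] {u v : X → ℝ}

lemma const (c : ℝ) : BddCont fun _ : X => c := ⟨continuous_const, |c|, fun _ => le_rfl⟩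

lemma mul (hu : BddCont u) (hv : BddCont v) : BddCont fun x => u x * v x := by
  obtain ⟨hu, C, hC⟩ := hu
  obtain ⟨hv, D, hD⟩ := hv
  refine ⟨hu.mul hv, C * D, fun x => ?_⟩
  rw [abs_mul]
  exact mul_le_mul (hC x) (hD x) (abs_nonneg _) ((abs_nonneg _).trans (hC x))

lemma add (hu : BddCont u) (hv : BddCont v) : BddCont fun x => u x + v x := by
  obtain ⟨hu, C, hC⟩ := hu
  obtain ⟨hv, D, hD⟩ := hv
  exact ⟨hu.add hv, C + D, fun x => (abs_add_le _ _).trans (add_le_add (hC x) (hD x))⟩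

lemma sub (hu : BddCont u) (hv : BddCont v) : BddCont fun x => u x - v x := by
  obtain ⟨hu, C, hC⟩ := hu
  obtain ⟨hv, D, hD⟩ := hv
  exact ⟨hu.sub hv, C + D, fun x => (abs_sub _ _).trans (add_le_add (hC x) (hD x))⟩

lemma pow (hu : BddCont u) (k : ℕ) : BddCont fun x => u x ^ k := by
  obtain ⟨hu, C, hC⟩ := hu
  refine ⟨hu.pow k, C ^ k, fun x => ?_⟩
  rw [abs_pow]
  exact pow_le_pow_left₀ (abs_nonneg _) (hC x) k

lemma abs (hu : BddCont u) : BddCont fun x => |u x| :=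
  ⟨hu.1.abs, hu.2.imp fun _ hC x => by rw [abs_abs]; exact hC x⟩

lemma sum {ι : Type*} [Fintype ι] {w : ι → X → ℝ} (hw : ∀ i, BddCont (w i)) :
    BddCont fun x => ∑ i, w i x := by
  choose hc C hC using hw
  exact ⟨continuous_finsetSum _ fun i _ => hc i, ∑ i, C i, fun x =>
    (Finset.abs_sum_le_sum_abs _ _).trans (Finset.sum_le_sum fun i _ => hC i x)⟩

lemma rpow (hu : BddCont u) {p : ℝ} (hp : 0 ≤ p) : BddCont fun x => |u x| ^ p := by
  obtain ⟨hu, C, hC⟩ := hu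
  refine ⟨hu.abs.rpow_const fun _ => Or.inr hp, C ^ p, fun x => ?_⟩
  rw [abs_of_nonneg (rpow_nonneg (abs_nonneg _) _)]
  exact rpow_le_rpow (abs_nonneg _) (hC x) hp

lemma comp {f : Y → X} (hu : BddCont u) (hf : Continuous f) : BddCont fun y => u (f y) :=
  ⟨hu.1.comp hf, hu.2.imp fun _ hC y => hC (f y)⟩

lemma exp_mul (hu : BddCont u) (c : ℝ) : BddCont fun x => rexp (c * u x) := by
  obtain ⟨hu, C, hC⟩ := hu
  refine ⟨by fun_prop, rexp (|c| * C), fun x => ?_⟩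
  rw [abs_of_pos (exp_pos _)]
  refine exp_le_exp.2 ((le_abs_self _).trans ?_)
  rw [abs_mul]
  exact mul_le_mul_of_nonneg_left (hC x) (abs_nonneg _)

variable [MeasurableSpace X] [OpensMeasurableSpace X]

lemma integrable (hu : BddCont u) (μ : Measure X) [IsFiniteMeasure μ] : Integrable u μ := by
  obtain ⟨hu, C, hC⟩ := hu
  exact Integrable.of_bound hu.measurable.aestronglyMeasurable C (ae_of_all _ hC)

lemma memLp (hu : BddCont u) (μ : Measure X) [IsFiniteMeasure μ] (p : ENNReal) :
    MemLp u p μ := by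
  obtain ⟨hu, C, hC⟩ := hu
  exact MemLp.of_bound hu.measurable.aestronglyMeasurable C (ae_of_all _ hC)

lemma integral [FirstCountableTopology Y] {F : Y → X → ℝ} (hF : BddCont fun p : Y × X => F p.1 p.2)
    (μ : Measure X) [IsProbabilityMeasure μ] : BddCont fun y => ∫ x, F y x ∂μ := by
  obtain ⟨hF, C, hC⟩ := hF
  refine ⟨?_, C, fun y => ?_⟩
  · refine continuous_of_dominated (bound := fun _ => C) (fun y => ?_)
      (fun y => ae_of_all _ fun x => hC (y, x)) (integrable_const _) (ae_of_all _ fun x => ?_)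
    · exact (hF.comp (Continuous.prodMk_right y)).measurable.aestronglyMeasurable
    · exact hF.comp (Continuous.prodMk_left x)
  · have := norm_integral_le_of_norm_le_const (μ := μ) (f := F y) (ae_of_all _ fun x => hC (y, x))
    simpa using this

end BddCont

section Inequalities

variable {X : Type*} [TopologicalSpace X] [MeasurableSpace X] [OpensMeasurableSpace X]
  {u v : X → ℝ} (μ : Measure X) [IsProbabilityMeasure μ]

lemma sq_integral_mul_le (hu : BddCont u) (hv : BddCont v) :
    (∫ x, u x * v x ∂μ) ^ 2 ≤ (∫ x, u x ^ 2 ∂μ) * ∫ x, v x ^ 2 ∂μ := by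
  have key : ∀ t : ℝ, 0 ≤ (∫ x, v x ^ 2 ∂μ) * (t * t) + (-2 * ∫ x, u x * v x ∂μ) * t
      + ∫ x, u x ^ 2 ∂μ := by
    intro t
    have h : 0 ≤ ∫ x, (u x - t * v x) ^ 2 ∂μ := integral_nonneg fun x => sq_nonneg _
    have e : ∀ x, (u x - t * v x) ^ 2 = u x ^ 2 - (2 * t) * (u x * v x) + t ^ 2 * v x ^ 2 :=
      fun x => by ring
    simp_rw [e] at h
    rw [integral_add (((hu.pow 2).sub ((BddCont.const (2 * t)).mul (hu.mul hv))).integrable μ)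
      (((BddCont.const (t ^ 2)).mul (hv.pow 2)).integrable μ),
      integral_sub ((hu.pow 2).integrable μ)
      (((BddCont.const (2 * t)).mul (hu.mul hv)).integrable μ), integral_const_mul,
      integral_const_mul] at h
    linarith
  have := discrim_le_zero key
  rw [discrim] at this
  linarith

lemma integral_mul_pow_three_le (hu : BddCont u) (hv : BddCont v) :
    (∫ x, |u x| * |v x| ∂μ) ^ 3 ≤
      (∫ x, |u x| ∂μ) * (∫ x, u x ^ 2 ∂μ) * ∫ x, |v x| ^ 3 ∂μ := by
  have hpq : Real.HolderConjugate 3 (3 / 2) := by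
    rw [Real.holderConjugate_iff]; norm_num
  have h1 := integral_mul_le_Lp_mul_Lq_of_nonneg hpq (μ := μ) (f := fun x => |v x|)
    (g := fun x => |u x|) (ae_of_all _ fun x => abs_nonneg _) (ae_of_all _ fun x => abs_nonneg _)
    (hv.abs.memLp μ _) (hu.abs.memLp μ _)
  have h2 := sq_integral_mul_le μ (hu.rpow (p := 1 / 2) (by norm_num)) hu.abs
  have e1 : ∀ x, |u x| ^ (1 / 2 : ℝ) * |u x| = |u x| ^ (3 / 2 : ℝ) := fun x => by
    rw [show (3 / 2 : ℝ) = 1 / 2 + 1 by norm_num, rpow_add_one' (abs_nonneg _) (by norm_num)]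
  have e2 : ∀ x, (|u x| ^ (1 / 2 : ℝ)) ^ 2 = |u x| := fun x => by
    rw [← rpow_natCast, ← rpow_mul (abs_nonneg _)]; norm_num
  simp_rw [e1, e2, sq_abs] at h2
  set A := ∫ x, |u x| ^ (3 / 2 : ℝ) ∂μ
  have hA : 0 ≤ A := integral_nonneg fun x => by positivity
  set B := ∫ x, |v x| ^ 3 ∂μ
  have hB : 0 ≤ B := integral_nonneg fun x => by positivity
  have e3 : ∫ x, |v x| ^ (3 : ℝ) ∂μ = B := by
    refine integral_congr_ae (ae_of_all _ fun x => ?_)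
    exact_mod_cast rpow_natCast (|v x|) 3
  rw [e3] at h1
  have e4 : ∫ x, |u x| * |v x| ∂μ = ∫ x, |v x| * |u x| ∂μ := by simp_rw [mul_comm]
  rw [e4]
  calc _ ≤ (B ^ (1 / 3 : ℝ) * A ^ (1 / (3 / 2) : ℝ)) ^ 3 :=
        pow_le_pow_left₀ (integral_nonneg fun x => by positivity) h1 3
    _ = B * A ^ 2 := by
        rw [mul_pow, ← rpow_natCast, ← rpow_natCast, ← rpow_mul hB, ← rpow_mul hA]
        norm_num
    _ ≤ _ := by
        rw [mul_comm B]
        exact mul_le_mul_of_nonneg_right h2 hB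

end Inequalities

section Rotation

variable {E : Type*} [NormedAddCommGroup E] [NormedSpace ℝ E] [MeasurableSpace E] [BorelSpace E]
  [SecondCountableTopology E] [CompleteSpace E] (μ : Measure E) [IsGaussian μ]

/-- A measure for which every continuous linear form has mean zero. -/
def Centered : Prop := ∀ L : StrongDual ℝ E, ∫ x, L x ∂μ = 0

variable {μ}

lemma Centered.prod (h0 : Centered μ) : Centered (μ.prod μ) := by
  intro L
  have hL : ∀ z : E × E, L z = (L.comp (ContinuousLinearMap.inl ℝ E E)) z.1
      + (L.comp (ContinuousLinearMap.inr ℝ E E)) z.2 := fun z => by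
    rw [ContinuousLinearMap.comp_apply, ContinuousLinearMap.comp_apply, ← map_add]
    simp
  simp_rw [hL]
  rw [integral_add, integral_fun_fst (f := ⇑(L.comp (ContinuousLinearMap.inl ℝ E E))),
    integral_fun_snd (f := ⇑(L.comp (ContinuousLinearMap.inr ℝ E E))), h0, h0]
  · simp
  · exact (IsGaussian.integrable_dual μ _).comp_fst μ
  · exact (IsGaussian.integrable_dual μ _).comp_snd μ

lemma Centered.map_rotation (h0 : Centered μ) (θ : ℝ) :
    MeasurePreserving (fun z : E × E => (cos θ • z.1 + sin θ • z.2, -sin θ • z.1 + cos θ • z.2))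
      (μ.prod μ) (μ.prod μ) :=
  ⟨(ContinuousLinearMap.rotation θ).continuous.measurable,
    IsGaussian.map_rotation_eq_self_of_forall_strongDual_eq_zero h0 θ⟩

lemma Centered.integral_rotation (h0 : Centered μ) (θ : ℝ) {F : E × E → ℝ} (hF : Continuous F) :
    ∫ z, F (cos θ • z.1 + sin θ • z.2, -sin θ • z.1 + cos θ • z.2) ∂μ.prod μ
      = ∫ z, F z ∂μ.prod μ := by
  have h := h0.map_rotation θ
  conv_rhs => rw [← h.map_eq]
  rw [integral_map h.measurable.aemeasurable hF.measurable.aestronglyMeasurable]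

/-- The Ornstein–Uhlenbeck (Mehler) operator with correlation `cos θ`. -/
noncomputable def mehler (μ : Measure E) (θ : ℝ) (u : E → ℝ) (x : E) : ℝ :=
  ∫ y, u (cos θ • x + sin θ • y) ∂μ

lemma BddCont.mehler {u : E → ℝ} (hu : BddCont u) (θ : ℝ) : BddCont (mehler μ θ u) :=
  BddCont.integral (F := fun x y => u (cos θ • x + sin θ • y)) (hu.comp (by fun_prop)) μ

lemma Centered.integral_comp_rotation (h0 : Centered μ) (θ : ℝ) {u : E → ℝ} (hu : BddCont u) :
    ∫ z, u (cos θ • z.1 + sin θ • z.2) ∂μ.prod μ = ∫ x, u x ∂μ := by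
  rw [h0.integral_rotation θ (F := fun z => u z.1) (hu.1.comp continuous_fst)]
  simp [integral_fun_fst]

lemma Centered.integral_mehler (h0 : Centered μ) (θ : ℝ) {u : E → ℝ} (hu : BddCont u) :
    ∫ x, mehler μ θ u x ∂μ = ∫ x, u x ∂μ := by
  rw [← h0.integral_comp_rotation θ hu,
    integral_prod _ ((hu.comp (by fun_prop)).integrable _)]
  rfl

lemma integral_mul_mehler (θ : ℝ) {u w : E → ℝ} (hu : BddCont u) (hw : BddCont w) :
    ∫ x, u x * mehler μ θ w x ∂μ = ∫ z, u z.1 * w (cos θ • z.1 + sin θ • z.2) ∂μ.prod μ := by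
  rw [integral_prod _ (((hu.comp continuous_fst).mul (hw.comp (by fun_prop))).integrable _)]
  simp_rw [integral_const_mul]
  rfl

lemma Centered.integral_mul_mehler_adjoint (h0 : Centered μ) (θ : ℝ) {u w : E → ℝ}
    (hu : BddCont u) (hw : BddCont w) :
    ∫ x, u x * mehler μ θ w x ∂μ = ∫ x, w x * mehler μ (-θ) u x ∂μ := by
  rw [integral_mul_mehler θ hu hw, integral_mul_mehler (-θ) hw hu]
  have hc := hu.1
  have hd := hw.1
  conv_rhs => rw [← h0.integral_rotation θ (by fun_prop)]
  refine integral_congr_ae (ae_of_all _ fun z => ?_)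
  have : cos (-θ) • (cos θ • z.1 + sin θ • z.2) + sin (-θ) • (-sin θ • z.1 + cos θ • z.2)
      = z.1 := by
    rw [cos_neg, sin_neg]
    have := cos_sq_add_sin_sq θ
    linear_combination (norm := module) this • z.1
  simp only [this]
  ring

lemma Centered.integral_comp_add (h0 : Centered μ) (α β : ℝ) {u : E → ℝ} (hu : BddCont u) :
    ∫ z, u (α • z.1 + β • z.2) ∂μ.prod μ = ∫ x, u (√(α ^ 2 + β ^ 2) • x) ∂μ := by
  set z : ℂ := ⟨α, β⟩
  have hn : ‖z‖ = √(α ^ 2 + β ^ 2) := Complex.norm_eq_sqrt_sq_add_sq z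
  have h1 : ‖z‖ * cos z.arg = α := Complex.norm_mul_cos_arg z
  have h2 : ‖z‖ * sin z.arg = β := Complex.norm_mul_sin_arg z
  rw [← hn, ← h0.integral_comp_rotation z.arg
    (u := fun x => u (‖z‖ • x)) (hu.comp (continuous_const_smul _))]
  refine integral_congr_ae (ae_of_all _ fun w => ?_)
  simp only [smul_add, smul_smul, h1, h2]

lemma Centered.integral_mehler_sq (h0 : Centered μ) {θ θ' : ℝ} (h : cos θ' = cos θ ^ 2)
    (hs : 0 ≤ sin θ') {u : E → ℝ} (hu : BddCont u) :
    ∫ x, mehler μ θ u x ^ 2 ∂μ = ∫ x, u x * mehler μ θ' u x ∂μ := by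
  simp_rw [sq (mehler μ θ u _)]
  rw [h0.integral_mul_mehler_adjoint θ (hu.mehler θ) hu]
  refine integral_congr_ae (ae_of_all _ fun x => ?_)
  simp only
  congr 1
  have e : mehler μ (-θ) (mehler μ θ u) x
      = ∫ z, u (cos θ' • x + ((-(cos θ * sin θ)) • z.1 + sin θ • z.2)) ∂μ.prod μ := by
    rw [integral_prod _ ((hu.comp (by fun_prop)).integrable _)]
    refine integral_congr_ae (ae_of_all _ fun y => ?_)
    refine integral_congr_ae (ae_of_all _ fun z => ?_)
    simp only [h, cos_neg, sin_neg]
    congr 1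
    module
  rw [e, h0.integral_comp_add _ _ (u := fun y => u (cos θ' • x + y)) (hu.comp (by fun_prop))]
  have hr : √((-(cos θ * sin θ)) ^ 2 + sin θ ^ 2) = sin θ' := by
    rw [← sqrt_sq hs]
    congr 1
    rw [sin_sq θ', h, neg_sq, mul_pow, sin_sq θ]
    ring
  rw [hr]
  rfl

end Rotation

section Hypercontractivity

variable {E : Type*} [NormedAddCommGroup E] [NormedSpace ℝ E] [MeasurableSpace E] [BorelSpace E]
  [SecondCountableTopology E] [CompleteSpace E] {μ : Measure E} [IsGaussian μ]

lemma Centered.triangle_le (h0 : Centered μ) {u : E → ℝ} (hu : BddCont u) (κ : ℝ)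
    (hκ : 2 * κ ^ 2 = 1) :
    ∫ a, ∫ z, u (κ • (a + z.1)) * u (κ • (a + z.2)) * u (κ • (z.1 + z.2)) ∂μ.prod μ ∂μ
      ≤ √(∫ x, u x ^ 2 ∂μ) ^ 3 := by
  set M := ∫ x, u x ^ 2 ∂μ with hM
  have hM0 : 0 ≤ M := integral_nonneg fun x => sq_nonneg _
  have hpair : ∫ z, u (κ • (z.1 + z.2)) ^ 2 ∂μ.prod μ = M := by
    simp_rw [smul_add]
    rw [h0.integral_comp_add κ κ (u := fun x => u x ^ 2) (hu.pow 2)]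
    have : √(κ ^ 2 + κ ^ 2) = 1 := by rw [← two_mul, hκ, sqrt_one]
    simp [this, hM]
  set m : E → ℝ := fun a => ∫ b, u (κ • (a + b)) ^ 2 ∂μ with hm
  have hmc : BddCont m :=
    BddCont.integral (F := fun a b => u (κ • (a + b)) ^ 2) ((hu.comp (by fun_prop)).pow 2) μ
  have hm0 : ∀ a, 0 ≤ m a := fun a => integral_nonneg fun x => sq_nonneg _
  have hmi : ∫ a, m a ∂μ = M := by
    rw [← hpair, integral_prod _ (((hu.comp (by fun_prop)).pow 2).integrable _)]
  have hle : ∀ a, ∫ z, u (κ • (a + z.1)) * u (κ • (a + z.2)) * u (κ • (z.1 + z.2)) ∂μ.prod μ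
      ≤ m a * √M := by
    intro a
    have h := sq_integral_mul_le (μ.prod μ)
      (u := fun z => u (κ • (a + z.1)) * u (κ • (a + z.2)))
      (v := fun z => u (κ • (z.1 + z.2)))
      ((hu.comp (by fun_prop)).mul (hu.comp (by fun_prop))) (hu.comp (by fun_prop))
    rw [hpair] at h
    simp_rw [mul_pow] at h
    rw [integral_prod_mul (fun x => u (κ • (a + x)) ^ 2) (fun x => u (κ • (a + x)) ^ 2)] at h
    refine abs_le_of_sq_le_sq' ?_ (mul_nonneg (hm0 a) (sqrt_nonneg _)) |>.2
    rw [mul_pow, sq_sqrt hM0]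
    rw [sq (m a)]
    exact h
  have hI : BddCont fun a : E =>
      ∫ z, u (κ • (a + z.1)) * u (κ • (a + z.2)) * u (κ • (z.1 + z.2)) ∂μ.prod μ :=
    BddCont.integral (F := fun (a : E) (z : E × E) =>
      u (κ • (a + z.1)) * u (κ • (a + z.2)) * u (κ • (z.1 + z.2)))
      (((hu.comp (by fun_prop)).mul (hu.comp (by fun_prop))).mul (hu.comp (by fun_prop))) _
  refine (integral_mono (hI.integrable μ) ((hmc.mul (BddCont.const _)).integrable μ) hle).trans ?_
  rw [integral_mul_const, hmi, pow_succ, sq_sqrt hM0]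

/-- The `L² → L³` hypercontractive estimate, at correlation `cos (-π / 4)`. -/
lemma Centered.integral_mehler_pow_three_le (h0 : Centered μ) {u : E → ℝ} (hu : BddCont u) :
    ∫ x, mehler μ (-(π / 4)) u x ^ 3 ∂μ ≤ √(∫ x, u x ^ 2 ∂μ) ^ 3 := by
  set κ : ℝ := √2 / 2 with hκ
  have hκ2 : 2 * κ ^ 2 = 1 := by
    rw [hκ, div_pow, sq_sqrt (by norm_num)]; norm_num
  have hc : cos (π / 4) = κ := cos_pi_div_four
  have hs : sin (π / 4) = κ := sin_pi_div_four
  let F : (E × E) × (E × E) → ℝ := fun w =>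
    u (κ • (w.1.1 - w.1.2)) * u (κ • (w.1.1 - w.2.1)) * u (κ • (w.1.1 - w.2.2))
  have hF : BddCont F :=
    ((hu.comp (by fun_prop)).mul (hu.comp (by fun_prop))).mul (hu.comp (by fun_prop))
  let B : E × E → E × E := fun z =>
    (cos (π / 4) • z.1 + sin (π / 4) • z.2, -sin (π / 4) • z.1 + cos (π / 4) • z.2)
  have hB : MeasurePreserving B (μ.prod μ) (μ.prod μ) := h0.map_rotation (π / 4)
  have hBc : Continuous B := by fun_prop
  have e1 : ∫ x, mehler μ (-(π / 4)) u x ^ 3 ∂μ = ∫ w, F w ∂(μ.prod μ).prod (μ.prod μ) := by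
    rw [integral_prod _ (hF.integrable _)]
    have hin : BddCont fun z : E × E => ∫ y, F (z, y) ∂μ.prod μ :=
      BddCont.integral (F := fun z y => F (z, y)) hF _
    rw [integral_prod _ (hin.integrable _)]
    refine integral_congr_ae (ae_of_all _ fun x => ?_)
    have hme : mehler μ (-(π / 4)) u x = ∫ y, u (κ • (x - y)) ∂μ := by
      simp only [mehler, cos_neg, sin_neg, hc, hs]
      refine integral_congr_ae (ae_of_all _ fun y => ?_)
      simp only
      congr 1
      module
    simp only [F, mul_assoc, integral_const_mul]
    rw [integral_mul_const, integral_prod_mul (fun y => u (κ • (x - y)))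
      (fun y => u (κ • (x - y))), hme]
    ring
  have e2 : ∫ w, F (B w.1, B w.2) ∂(μ.prod μ).prod (μ.prod μ)
      = ∫ w, F w ∂(μ.prod μ).prod (μ.prod μ) := by
    have h := hB.prod hB
    conv_rhs => rw [← h.map_eq]
    rw [integral_map h.measurable.aemeasurable hF.1.measurable.aestronglyMeasurable]
    rfl
  have hG : BddCont fun w : (E × E) × (E × E) => F (B w.1, B w.2) := hF.comp (by fun_prop)
  have e3 := h0.prod.integral_rotation (π / 4) hG.1
  have e4 : ∀ w : (E × E) × (E × E),
      F (B (cos (π / 4) • w.1 + sin (π / 4) • w.2), B (-sin (π / 4) • w.1 + cos (π / 4) • w.2))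
      = u (κ • (w.1.1 + w.2.1)) * u (κ • (w.1.1 + w.1.2)) * u (κ • (w.1.2 + w.2.1)) := by
    rintro ⟨⟨a, b⟩, ⟨c, d⟩⟩
    simp only [F, B, hc, hs, Prod.smul_mk, Prod.mk_add_mk]
    congr 1
    · congr 1
      · congr 2
        linear_combination (norm := module) hκ2 • (a + c)
      · congr 2
        linear_combination (norm := module) hκ2 • (a + b)
    · congr 2
      linear_combination (norm := module) hκ2 • (b + c)
  rw [e1, ← e2, ← e3]
  simp_rw [e4]
  refine le_trans (le_of_eq ?_) (h0.triangle_le hu κ hκ2)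
  have hK : BddCont fun w : (E × E) × (E × E) =>
      u (κ • (w.1.1 + w.2.1)) * u (κ • (w.1.1 + w.1.2)) * u (κ • (w.1.2 + w.2.1)) :=
    ((hu.comp (by fun_prop)).mul (hu.comp (by fun_prop))).mul (hu.comp (by fun_prop))
  rw [integral_prod _ (hK.integrable _)]
  have e5 : ∀ z : E × E, ∫ y : E × E,
      u (κ • (z.1 + y.1)) * u (κ • (z.1 + z.2)) * u (κ • (z.2 + y.1)) ∂μ.prod μ
      = ∫ c, u (κ • (z.1 + z.2)) * u (κ • (z.1 + c)) * u (κ • (z.2 + c)) ∂μ := by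
    intro z
    rw [integral_fun_fst
      (f := fun c => u (κ • (z.1 + c)) * u (κ • (z.1 + z.2)) * u (κ • (z.2 + c)))]
    simp only [probReal_univ, one_smul]
    refine integral_congr_ae (ae_of_all _ fun y => ?_)
    ring
  simp_rw [e5]
  have hin : BddCont fun z : E × E =>
      ∫ c, u (κ • (z.1 + z.2)) * u (κ • (z.1 + c)) * u (κ • (z.2 + c)) ∂μ :=
    BddCont.integral (F := fun (z : E × E) (c : E) =>
      u (κ • (z.1 + z.2)) * u (κ • (z.1 + c)) * u (κ • (z.2 + c)))
      (((hu.comp (by fun_prop)).mul (hu.comp (by fun_prop))).mul (hu.comp (by fun_prop))) _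
  rw [integral_prod _ (hin.integrable _)]
  refine integral_congr_ae (ae_of_all _ fun a => ?_)
  simp only
  rw [integral_prod]
  exact (((hu.comp (by fun_prop)).mul (hu.comp (by fun_prop))).mul
    (hu.comp (by fun_prop))).integrable _

/-- A hypercontractive estimate for the Mehler operator, interpolating between `L¹` and `L²`. -/
lemma Centered.integral_mehler_sq_pow_three_le (h0 : Centered μ) {u : E → ℝ} (hu : BddCont u) :
    (∫ x, mehler μ (π / 4) u x ^ 2 ∂μ) ^ 3 ≤ (∫ x, |u x| ∂μ) ^ 2 * (∫ x, u x ^ 2 ∂μ) ^ 2 := by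
  set w := mehler μ (π / 4) u with hw
  have hwc : BddCont w := hu.mehler _
  set h := mehler μ (-(π / 4)) w with hh
  have hhc : BddCont h := hwc.mehler _
  set N := ∫ x, w x ^ 2 ∂μ with hN
  have hN0 : 0 ≤ N := integral_nonneg fun x => sq_nonneg _
  set A := ∫ x, |u x| ∂μ
  set B := ∫ x, u x ^ 2 ∂μ
  have hA : 0 ≤ A := integral_nonneg fun x => abs_nonneg _
  have hB : 0 ≤ B := integral_nonneg fun x => sq_nonneg _
  have h1 : N = ∫ x, u x * h x ∂μ := by
    rw [← h0.integral_mul_mehler_adjoint (π / 4) hwc hu]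
    simp_rw [hN, sq]
    rfl
  have h2 : N ≤ ∫ x, |u x| * |h x| ∂μ := by
    rw [h1]
    refine integral_mono ((hu.mul hhc).integrable μ) ((hu.abs.mul hhc.abs).integrable μ) fun x => ?_
    simp only
    rw [← abs_mul]
    exact le_abs_self _
  have h3 := integral_mul_pow_three_le μ hu hhc
  have h4 : ∫ x, |h x| ^ 3 ∂μ ≤ √N ^ 3 := by
    have := h0.integral_mehler_pow_three_le hwc.abs
    simp_rw [sq_abs] at this
    refine le_trans (integral_mono ((hhc.abs.pow 3).integrable μ)
      (((hwc.abs.mehler _).pow 3).integrable μ) fun x => ?_) this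
    refine pow_le_pow_left₀ (abs_nonneg _) ?_ 3
    simp only [hh, mehler]
    exact abs_integral_le_integral_abs
  have h5 : N ^ 3 ≤ A * B * √N ^ 3 :=
    (pow_le_pow_left₀ hN0 h2 3).trans (h3.trans (mul_le_mul_of_nonneg_left h4 (by positivity)))
  have h6 : √N ^ 3 ≤ A * B := by
    rcases (sqrt_nonneg N).eq_or_lt with h | h
    · rw [← h, zero_pow three_ne_zero]; exact mul_nonneg hA hB
    · have : N ^ 3 = √N ^ 3 * √N ^ 3 := by
        rw [← mul_pow, mul_self_sqrt hN0]
      rw [this] at h5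
      exact le_of_mul_le_mul_right h5 (by positivity)
  calc N ^ 3 = (√N ^ 3) ^ 2 := by rw [← pow_mul, mul_comm, pow_mul, sq_sqrt hN0]
    _ ≤ (A * B) ^ 2 := pow_le_pow_left₀ (by positivity) h6 2
    _ = _ := by ring

end Hypercontractivity

section RotationPath

variable {E : Type*} [NormedAddCommGroup E] [NormedSpace ℝ E] [MeasurableSpace E] [BorelSpace E]
  [SecondCountableTopology E] [CompleteSpace E] {μ : Measure E} [IsGaussian μ]

lemma hasDerivAt_comp_rotation {g : E → ℝ} (hg : ContDiff ℝ 1 g) (θ : ℝ) (z : E × E) (s : ℝ) :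
    HasDerivAt (fun s => g (cos (θ * s) • z.1 + sin (θ * s) • z.2))
      (θ * fderiv ℝ g (cos (θ * s) • z.1 + sin (θ * s) • z.2)
        (-sin (θ * s) • z.1 + cos (θ * s) • z.2)) s := by
  have h1 : HasDerivAt (fun s : ℝ => θ * s) θ s := by
    simpa using (hasDerivAt_id s).const_mul θ
  have h2 : HasDerivAt (fun s => cos (θ * s) • z.1 + sin (θ * s) • z.2)
      (θ • (-sin (θ * s) • z.1 + cos (θ * s) • z.2)) s := by
    refine ((h1.cos.smul_const z.1).add (h1.sin.smul_const z.2)).congr_deriv ?_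
    module
  have h3 := ((hg.differentiable one_ne_zero _).hasFDerivAt (x :=
    cos (θ * s) • z.1 + sin (θ * s) • z.2)).comp_hasDerivAt s h2
  rw [map_smul, smul_eq_mul] at h3
  exact h3

/-- Convex functionals of the increment of `g` under a rotation are controlled by those of its
derivative. -/
lemma Centered.lintegral_convex_rotation_le (h0 : Centered μ) {g : E → ℝ} (hg : ContDiff ℝ 1 g)
    (θ : ℝ) {ψ : ℝ → ℝ} (hψ : ConvexOn ℝ univ ψ) (hψc : Continuous ψ) (hψ0 : ∀ r, 0 ≤ ψ r) :
    ∫⁻ z, ENNReal.ofReal (ψ (g (cos θ • z.1 + sin θ • z.2) - g z.1)) ∂μ.prod μ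
      ≤ ∫⁻ z, ENNReal.ofReal (ψ (θ * fderiv ℝ g z.1 z.2)) ∂μ.prod μ := by
  set ν : Measure ℝ := volume.restrict (Ioc 0 1) with hν
  have : IsProbabilityMeasure ν := ⟨by simp [hν]⟩
  have hdc : Continuous (fderiv ℝ g) := hg.continuous_fderiv one_ne_zero
  let D : E × E → ℝ := fun z => ψ (θ * fderiv ℝ g z.1 z.2)
  have hD : Continuous D :=
    hψc.comp (continuous_const.mul ((hdc.comp continuous_fst).clm_apply continuous_snd))
  let R : ℝ → E × E → E × E := fun s z =>
    (cos (θ * s) • z.1 + sin (θ * s) • z.2, -sin (θ * s) • z.1 + cos (θ * s) • z.2)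
  have hR : Continuous fun p : (E × E) × ℝ => R p.2 p.1 := by fun_prop
  have key : ∀ z : E × E, ENNReal.ofReal (ψ (g (cos θ • z.1 + sin θ • z.2) - g z.1))
      ≤ ∫⁻ s, ENNReal.ofReal (D (R s z)) ∂ν := by
    intro z
    have hR' : Continuous fun s : ℝ => R s z := by fun_prop
    let γ' : ℝ → ℝ := fun s => θ * fderiv ℝ g (R s z).1 (R s z).2
    have hγ'c : Continuous γ' := continuous_const.mul
      ((hdc.comp hR'.fst).clm_apply hR'.snd)
    have hint : ∀ {f : ℝ → ℝ}, Continuous f → Integrable f ν := fun hf =>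
      (hf.integrableOn_Icc (a := 0) (b := 1)).mono_set Ioc_subset_Icc_self
    have e1 : g (cos θ • z.1 + sin θ • z.2) - g z.1 = ∫ s, γ' s ∂ν := by
      have := intervalIntegral.integral_eq_sub_of_hasDerivAt (a := 0) (b := 1)
        (fun s _ => hasDerivAt_comp_rotation hg θ z s) (hγ'c.intervalIntegrable 0 1)
      rw [intervalIntegral.integral_of_le zero_le_one] at this
      rw [this]
      simp
    have hDR : Continuous fun s => D (R s z) := hD.comp hR'
    rw [e1, ← ofReal_integral_eq_lintegral_ofReal (hint hDR) (ae_of_all _ fun s => hψ0 _)]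
    refine ENNReal.ofReal_le_ofReal ?_
    exact hψ.map_integral_le hψc.continuousOn isClosed_univ (ae_of_all _ fun _ => mem_univ _)
      (hint hγ'c) (hint (hψc.comp hγ'c))
  calc _ ≤ ∫⁻ z, ∫⁻ s, ENNReal.ofReal (D (R s z)) ∂ν ∂μ.prod μ := lintegral_mono key
    _ = ∫⁻ s, ∫⁻ z, ENNReal.ofReal (D (R s z)) ∂μ.prod μ ∂ν :=
        lintegral_lintegral_swap (ENNReal.continuous_ofReal.comp
          (hD.comp hR)).measurable.aemeasurable
    _ = ∫⁻ s, ∫⁻ z, ENNReal.ofReal (D z) ∂μ.prod μ ∂ν := by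
        refine lintegral_congr fun s => ?_
        exact (h0.map_rotation (θ * s)).lintegral_comp
          (ENNReal.continuous_ofReal.comp hD).measurable
    _ = _ := by simp [D]

end RotationPath

section StandardGaussian

variable {n : ℕ}

instance isProbabilityMeasure_stdGaussian_pi : IsProbabilityMeasure (_root_.stdGaussian n) := by
  unfold _root_.stdGaussian; infer_instance

lemma stdGaussian_eq_map : _root_.stdGaussian n
    = (ProbabilityTheory.stdGaussian (EuclideanSpace ℝ (Fin n))).map
      (EuclideanSpace.equiv (Fin n) ℝ) := by
  rw [← map_pi_eq_stdGaussian, Measure.map_map (by fun_prop) (by fun_prop)]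
  exact Measure.map_id.symm

instance isGaussian_stdGaussian_pi : IsGaussian (_root_.stdGaussian n) := by
  rw [stdGaussian_eq_map]
  infer_instance

lemma strongDual_apply_eq_sum (L : StrongDual ℝ (Fin n → ℝ)) (v : Fin n → ℝ) :
    L v = ∑ i, v i * L (Pi.single i 1) := by
  conv_lhs => rw [← ContinuousLinearMap.coe_coe, LinearMap.pi_apply_eq_sum_univ L.toLinearMap v]
  refine Finset.sum_congr rfl fun i _ => ?_
  rw [smul_eq_mul, ContinuousLinearMap.coe_coe]
  congr 2
  ext j
  simp [Pi.single_apply, eq_comm]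

lemma map_dual_stdGaussian (L : StrongDual ℝ (Fin n → ℝ)) :
    (_root_.stdGaussian n).map L
      = gaussianReal 0 (∑ i, L (Pi.single i 1) ^ 2).toNNReal := by
  have hL : ⇑L = ∑ i, fun x : Fin n → ℝ => L (Pi.single i 1) * x i := by
    ext x
    simp [strongDual_apply_eq_sum L x, mul_comm]
  rw [IsGaussian.map_eq_gaussianReal]
  congr 1
  · rw [stdGaussian_eq_map, integral_map (by fun_prop) (by fun_prop)]
    exact integral_strongDual_stdGaussian (L.comp
      (EuclideanSpace.equiv (Fin n) ℝ).toContinuousLinearMap)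
  · congr 1
    conv_lhs => rw [hL]
    unfold _root_.stdGaussian
    rw [variance_sum_pi (X := fun i x => L (Pi.single i 1) * x)]
    · refine Finset.sum_congr rfl fun i _ => ?_
      rw [variance_const_mul]
      simp [variance_fun_id_gaussianReal]
    · exact fun i => (memLp_id_gaussianReal 2).const_mul _

lemma centered_stdGaussian : Centered (_root_.stdGaussian n) := by
  intro L
  have h := integral_map (μ := _root_.stdGaussian n) L.continuous.aemeasurable
    (f := fun x => x) (by fun_prop)
  rw [← h, map_dual_stdGaussian, integral_id_gaussianReal]

lemma lintegral_dual_sq_stdGaussian (L : StrongDual ℝ (Fin n → ℝ)) :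
    ∫⁻ y, ENNReal.ofReal (L y ^ 2) ∂_root_.stdGaussian n
      = ENNReal.ofReal (∑ i, L (Pi.single i 1) ^ 2) := by
  rw [← ofReal_integral_eq_lintegral_ofReal ((IsGaussian.memLp_dual _ L 2 (by simp)).integrable_sq)
    (ae_of_all _ fun _ => sq_nonneg _)]
  congr 1
  have h := variance_of_integral_eq_zero (μ := _root_.stdGaussian n) (X := L)
    L.continuous.aemeasurable (centered_stdGaussian L)
  rw [← h, ← variance_id_map L.continuous.aemeasurable, map_dual_stdGaussian,
    variance_id_gaussianReal, coe_toNNReal _ (Finset.sum_nonneg fun i _ => sq_nonneg _)]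

lemma lintegral_exp_dual_stdGaussian (L : StrongDual ℝ (Fin n → ℝ)) (t : ℝ) :
    ∫⁻ y, ENNReal.ofReal (rexp (t * L y)) ∂_root_.stdGaussian n
      = ENNReal.ofReal (rexp ((∑ i, L (Pi.single i 1) ^ 2) * t ^ 2 / 2)) := by
  have h := mgf_gaussianReal (map_dual_stdGaussian L) t
  rw [coe_toNNReal _ (Finset.sum_nonneg fun i _ => sq_nonneg _), zero_mul, zero_add] at h
  rw [← ofReal_integral_eq_lintegral_ofReal _ (ae_of_all _ fun _ => (exp_pos _).le)]
  · exact congrArg _ h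
  · by_contra hc
    have := mgf_undef (X := L) hc
    rw [h] at this
    exact (exp_pos _).ne' this

end StandardGaussian

section Energy

variable {n : ℕ}

/-- Bounded continuously differentiable functions with bounded derivative. -/
structure BddContDiff (g : (Fin n → ℝ) → ℝ) : Prop where
  contDiff : ContDiff ℝ 1 g
  bdd : ∃ C, ∀ x, |g x| ≤ C
  bdd_fderiv : ∃ C, ∀ x, ‖fderiv ℝ g x‖ ≤ C

/-- The partial derivative of `g` in the direction of the `i`-th basis vector. -/
noncomputable def pderiv (g : (Fin n → ℝ) → ℝ) (i : Fin n) (x : Fin n → ℝ) : ℝ :=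
  fderiv ℝ g x (Pi.single i 1)

lemma BddContDiff.bddCont {g : (Fin n → ℝ) → ℝ} (hg : BddContDiff g) : BddCont g :=
  ⟨hg.contDiff.continuous, hg.bdd⟩

lemma BddContDiff.pderiv {g : (Fin n → ℝ) → ℝ} (hg : BddContDiff g) (i : Fin n) :
    BddCont (pderiv g i) := by
  obtain ⟨C, hC⟩ := hg.bdd_fderiv
  refine ⟨(hg.contDiff.continuous_fderiv one_ne_zero).clm_apply continuous_const,
    C * ‖(Pi.single i 1 : Fin n → ℝ)‖, fun x => ?_⟩
  exact ((fderiv ℝ g x).le_opNorm _).trans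
    (mul_le_mul_of_nonneg_right (hC x) (norm_nonneg _))

lemma BddContDiff.sum_pderiv_sq {g : (Fin n → ℝ) → ℝ} (hg : BddContDiff g) :
    BddCont fun x => ∑ i, _root_.pderiv g i x ^ 2 :=
  BddCont.sum fun i => (hg.pderiv i).pow 2

lemma BddContDiff.integral_sq_increment_le {g : (Fin n → ℝ) → ℝ} (hg : BddContDiff g) (θ : ℝ) :
    ∫ z, (g (cos θ • z.1 + sin θ • z.2) - g z.1) ^ 2
        ∂(_root_.stdGaussian n).prod (_root_.stdGaussian n)
      ≤ θ ^ 2 * ∫ x, ∑ i, _root_.pderiv g i x ^ 2 ∂_root_.stdGaussian n := by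
  have hb := hg.bddCont
  have h := centered_stdGaussian.lintegral_convex_rotation_le hg.contDiff θ
    (ψ := fun r => r ^ 2) (even_two.convexOn_pow) (by fun_prop) (fun r => sq_nonneg r)
  have h1 : BddCont fun z : (Fin n → ℝ) × (Fin n → ℝ) =>
      (g (cos θ • z.1 + sin θ • z.2) - g z.1) ^ 2 :=
    ((hb.comp (f := fun z : (Fin n → ℝ) × (Fin n → ℝ) => cos θ • z.1 + sin θ • z.2)
      (by fun_prop)).sub (hb.comp continuous_fst)).pow 2
  rw [← ofReal_integral_eq_lintegral_ofReal (h1.integrable _) (ae_of_all _ fun _ => sq_nonneg _),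
    lintegral_prod _ (by
      have := hg.contDiff.continuous_fderiv one_ne_zero
      exact (ENNReal.continuous_ofReal.comp (by fun_prop)).aemeasurable)] at h
  simp_rw [mul_pow, ENNReal.ofReal_mul (sq_nonneg θ)] at h
  have h2 : ∀ x, ∫⁻ y, ENNReal.ofReal (θ ^ 2) * ENNReal.ofReal (fderiv ℝ g x y ^ 2)
      ∂_root_.stdGaussian n
      = ENNReal.ofReal (θ ^ 2) * ENNReal.ofReal (∑ i, _root_.pderiv g i x ^ 2) := by
    intro x
    rw [lintegral_const_mul' _ _ ENNReal.ofReal_ne_top, lintegral_dual_sq_stdGaussian]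
    rfl
  simp_rw [h2] at h
  rw [lintegral_const_mul' _ _ ENNReal.ofReal_ne_top,
    ← ofReal_integral_eq_lintegral_ofReal (hg.sum_pderiv_sq.integrable _)
      (ae_of_all _ fun _ => Finset.sum_nonneg fun _ _ => sq_nonneg _),
    ← ENNReal.ofReal_mul (sq_nonneg θ)] at h
  exact (ENNReal.ofReal_le_ofReal_iff (mul_nonneg (sq_nonneg θ)
    (integral_nonneg fun _ => Finset.sum_nonneg fun _ _ => sq_nonneg _))).1 h

lemma BddContDiff.integral_sq_sub_le {g : (Fin n → ℝ) → ℝ} (hg : BddContDiff g) (θ : ℝ) :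
    2 * ∫ x, g x ^ 2 ∂_root_.stdGaussian n
        - 2 * ∫ x, g x * mehler (_root_.stdGaussian n) θ g x ∂_root_.stdGaussian n
      ≤ θ ^ 2 * ∫ x, ∑ i, _root_.pderiv g i x ^ 2 ∂_root_.stdGaussian n := by
  have hb := hg.bddCont
  refine le_trans (le_of_eq ?_) (hg.integral_sq_increment_le θ)
  have b1 : BddCont fun z : (Fin n → ℝ) × (Fin n → ℝ) => g (cos θ • z.1 + sin θ • z.2) :=
    hb.comp (by fun_prop)
  have b0 : BddCont fun z : (Fin n → ℝ) × (Fin n → ℝ) => g z.1 := hb.comp continuous_fst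
  have e : ∀ z : (Fin n → ℝ) × (Fin n → ℝ), (g (cos θ • z.1 + sin θ • z.2) - g z.1) ^ 2
      = g (cos θ • z.1 + sin θ • z.2) ^ 2 + g z.1 ^ 2
        - 2 * (g z.1 * g (cos θ • z.1 + sin θ • z.2)) := fun z => by ring
  simp_rw [e]
  rw [integral_sub (((b1.pow 2).add (b0.pow 2)).integrable _)
    (((b0.mul b1).integrable _).const_mul 2), integral_add ((b1.pow 2).integrable _)
    ((b0.pow 2).integrable _), integral_const_mul, ← integral_mul_mehler θ hb hb,
    centered_stdGaussian.integral_comp_rotation θ (hb.pow 2),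
    integral_fun_fst (f := fun x => g x ^ 2)]
  simp
  ring

/-- A Gaussian Poincaré inequality. -/
lemma BddContDiff.integral_sq_le {g : (Fin n → ℝ) → ℝ} (hg : BddContDiff g)
    (h0 : ∫ x, g x ∂_root_.stdGaussian n = 0) :
    ∫ x, g x ^ 2 ∂_root_.stdGaussian n
      ≤ π ^ 2 / 8 * ∫ x, ∑ i, _root_.pderiv g i x ^ 2 ∂_root_.stdGaussian n := by
  have h := hg.integral_sq_sub_le (π / 2)
  have e : ∀ x, mehler (_root_.stdGaussian n) (π / 2) g x = 0 := fun x => by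
    simp [mehler, h0]
  simp_rw [e] at h
  simp at h
  linarith

/-- Exponential concentration for smooth functions with bounded Euclidean gradient. -/
lemma BddContDiff.integral_exp_le {g : (Fin n → ℝ) → ℝ} (hg : BddContDiff g) {B : ℝ}
    (hB : ∀ x, ∑ i, _root_.pderiv g i x ^ 2 ≤ B) (l : ℝ) :
    ∫ x, rexp (l * g x) ∂_root_.stdGaussian n
      ≤ rexp (l * ∫ x, g x ∂_root_.stdGaussian n) * rexp (l ^ 2 * π ^ 2 * B / 8) := by
  have hb := hg.bddCont
  have h := centered_stdGaussian.lintegral_convex_rotation_le hg.contDiff (π / 2)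
    (ψ := fun r => rexp (l * r)) (convexOn_exp.comp_linearMap (LinearMap.mulLeft ℝ l))
    (by fun_prop) (fun r => (exp_pos _).le)
  rw [lintegral_prod (fun z => ENNReal.ofReal (rexp (l * (π / 2 * fderiv ℝ g z.1 z.2)))) (by
      have := hg.contDiff.continuous_fderiv one_ne_zero
      exact (ENNReal.continuous_ofReal.comp (by fun_prop)).aemeasurable)] at h
  simp_rw [← mul_assoc l, lintegral_exp_dual_stdGaussian] at h
  have h2 : ∫⁻ x, ENNReal.ofReal (rexp ((∑ i, fderiv ℝ g x (Pi.single i 1) ^ 2)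
      * (l * (π / 2)) ^ 2 / 2)) ∂_root_.stdGaussian n
      ≤ ENNReal.ofReal (rexp (l ^ 2 * π ^ 2 * B / 8)) := by
    refine (lintegral_mono fun x => ENNReal.ofReal_le_ofReal (exp_le_exp.2 ?_)).trans
      (le_of_eq (by rw [lintegral_const, measure_univ, mul_one]))
    have := mul_le_mul_of_nonneg_right (hB x) (sq_nonneg (l * π))
    simp only [_root_.pderiv] at this
    linarith
  have h3 := h.trans h2
  have e : ∀ z : (Fin n → ℝ) × (Fin n → ℝ),
      rexp (l * (g (cos (π / 2) • z.1 + sin (π / 2) • z.2) - g z.1))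
        = rexp (-l * g z.1) * rexp (l * g z.2) := fun z => by
    rw [← exp_add, cos_pi_div_two, sin_pi_div_two, zero_smul, one_smul, zero_add]
    ring_nf
  simp_rw [e] at h3
  have b1 : BddCont fun z : (Fin n → ℝ) × (Fin n → ℝ) =>
      rexp (-l * g z.1) * rexp (l * g z.2) :=
    ((hb.exp_mul (-l)).comp continuous_fst).mul ((hb.exp_mul l).comp continuous_snd)
  rw [← ofReal_integral_eq_lintegral_ofReal (b1.integrable _)
    (ae_of_all _ fun _ => by positivity), ENNReal.ofReal_le_ofReal_iff (exp_pos _).le,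
    integral_prod_mul (fun x => rexp (-l * g x)) (fun x => rexp (l * g x))] at h3
  have hJ : rexp (-l * ∫ x, g x ∂_root_.stdGaussian n)
      ≤ ∫ x, rexp (-l * g x) ∂_root_.stdGaussian n := by
    rw [← integral_const_mul]
    exact convexOn_exp.map_integral_le continuous_exp.continuousOn isClosed_univ
      (ae_of_all _ fun _ => mem_univ _) ((hb.integrable _).const_mul _)
      ((hb.exp_mul (-l)).integrable _)
  have h4 := (mul_le_mul_of_nonneg_right hJ
    (integral_nonneg fun x => (exp_pos (l * g x)).le)).trans h3
  rw [neg_mul, exp_neg, inv_mul_le_iff₀ (exp_pos _)] at h4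
  exact h4

end Energy

section LowerBound

variable {n : ℕ}

/-- The angles `θₖ` with `cos θₖ = 2 ^ (-1 / 2 ^ k)`. -/
noncomputable def dyadicAngle (k : ℕ) : ℝ := arccos (rexp (-(log 2 / 2 ^ k)))

lemma cos_dyadicAngle (k : ℕ) : cos (dyadicAngle k) = rexp (-(log 2 / 2 ^ k)) := by
  refine cos_arccos (by linarith [exp_pos (-(log 2 / 2 ^ k))]) (exp_le_one_iff.2 ?_)
  have := log_pos one_lt_two
  have : 0 ≤ log 2 / 2 ^ k := by positivity
  linarith

lemma cos_dyadicAngle_succ (k : ℕ) : cos (dyadicAngle k) = cos (dyadicAngle (k + 1)) ^ 2 := by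
  rw [cos_dyadicAngle, cos_dyadicAngle, ← exp_nat_mul]
  congr 1
  push_cast
  field_simp
  ring

lemma sin_dyadicAngle_nonneg (k : ℕ) : 0 ≤ sin (dyadicAngle k) :=
  sin_nonneg_of_nonneg_of_le_pi (arccos_nonneg _) (arccos_le_pi _)

lemma dyadicAngle_sq_le (k : ℕ) : dyadicAngle k ^ 2 ≤ 4 / 2 ^ k := by
  have h := cos_le_one_sub_mul_cos_sq (x := dyadicAngle k) (by
    rw [dyadicAngle, abs_of_nonneg (arccos_nonneg _)]; exact arccos_le_pi _)
  rw [cos_dyadicAngle] at h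
  have h1 := add_one_le_exp (-(log 2 / 2 ^ k))
  have h2 : 2 / π ^ 2 * dyadicAngle k ^ 2 ≤ log 2 / 2 ^ k := by linarith
  have h3 : dyadicAngle k ^ 2 ≤ π ^ 2 / 2 * (log 2 / 2 ^ k) := by
    have := mul_le_mul_of_nonneg_left h2 (by positivity : 0 ≤ π ^ 2 / 2)
    refine le_trans (le_of_eq ?_) this
    field_simp
  refine h3.trans ?_
  rw [← mul_div_assoc]
  refine div_le_div_of_nonneg_right ?_ (by positivity)
  have hp : π ^ 2 ≤ 10 := by nlinarith [pi_lt_d2, pi_pos]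
  nlinarith [log_two_lt_d9, log_pos one_lt_two, pi_pos]

/-- A lower bound for the `L²` norm of the Mehler transform in terms of the ratio between the
energy and the `L²` norm. -/
lemma BddContDiff.mul_exp_le_integral_mehler_sq {g : (Fin n → ℝ) → ℝ} (hg : BddContDiff g)
    {V I : ℝ} (hV : V = ∫ x, g x ^ 2 ∂_root_.stdGaussian n) (hV0 : 0 < V)
    (hI : I = ∫ x, ∑ i, _root_.pderiv g i x ^ 2 ∂_root_.stdGaussian n) :
    V * rexp (-(2 * I / V))
      ≤ ∫ x, mehler (_root_.stdGaussian n) (π / 4) g x ^ 2 ∂_root_.stdGaussian n := by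
  have hb := hg.bddCont
  have hI0 : 0 ≤ I := hI ▸ integral_nonneg fun _ => Finset.sum_nonneg fun _ _ => sq_nonneg _
  set a : ℕ → ℝ := fun k =>
    ∫ x, g x * mehler (_root_.stdGaussian n) (dyadicAngle k) g x ∂_root_.stdGaussian n with ha
  have hsq : ∀ k, ∫ x, mehler (_root_.stdGaussian n) (dyadicAngle (k + 1)) g x ^ 2
      ∂_root_.stdGaussian n = a k := fun k =>
    centered_stdGaussian.integral_mehler_sq (cos_dyadicAngle_succ k) (sin_dyadicAngle_nonneg k) hb
  have h0 : ∫ x, mehler (_root_.stdGaussian n) (π / 4) g x ^ 2 ∂_root_.stdGaussian n = a 0 := by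
    refine centered_stdGaussian.integral_mehler_sq ?_ (sin_dyadicAngle_nonneg 0) hb
    rw [cos_dyadicAngle, cos_pi_div_four, div_pow, sq_sqrt zero_le_two, pow_zero, div_one, exp_neg,
      exp_log two_pos]
    norm_num
  have hstep : ∀ k, a (k + 1) ^ 2 ≤ V * a k := fun k => by
    rw [← hsq k, hV]
    exact sq_integral_mul_le _ hb (hb.mehler _)
  have hind : ∀ k, V * a k ^ 2 ^ k ≤ V ^ 2 ^ k * a 0 := by
    intro k
    induction k with
    | zero => simp
    | succ k ih =>
      calc V * a (k + 1) ^ 2 ^ (k + 1) = V * (a (k + 1) ^ 2) ^ 2 ^ k := by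
            rw [← pow_mul, pow_succ' 2 k]
        _ ≤ V * (V * a k) ^ 2 ^ k :=
            mul_le_mul_of_nonneg_left (pow_le_pow_left₀ (sq_nonneg _) (hstep k) _) hV0.le
        _ = V ^ 2 ^ k * (V * a k ^ 2 ^ k) := by rw [mul_pow]; ring
        _ ≤ V ^ 2 ^ k * (V ^ 2 ^ k * a 0) := mul_le_mul_of_nonneg_left ih (by positivity)
        _ = V ^ 2 ^ (k + 1) * a 0 := by rw [pow_succ 2 k, mul_two, pow_add]; ring
  have hlow : ∀ k, V * (1 + -(2 * I / V) / (2 ^ k : ℕ)) ≤ a k := fun k => by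
    have h1 := hg.integral_sq_sub_le (dyadicAngle k)
    rw [← hV, ← hI] at h1
    have h2 := mul_le_mul_of_nonneg_right (dyadicAngle_sq_le k) hI0
    have e : V * (1 + -(2 * I / V) / (2 ^ k : ℕ)) = V - 4 / 2 ^ k * I / 2 := by
      push_cast
      field_simp
      ring
    rw [e]
    simp only [ha]
    linarith
  have hlim : Tendsto (fun k : ℕ => V * (1 + -(2 * I / V) / (2 ^ k : ℕ)) ^ 2 ^ k) atTop
      (𝓝 (V * rexp (-(2 * I / V)))) :=
    ((tendsto_one_add_div_pow_exp (-(2 * I / V))).comp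
      (tendsto_pow_atTop_atTop_of_one_lt one_lt_two)).const_mul V
  have hpos : ∀ᶠ k : ℕ in atTop, 0 ≤ 1 + -(2 * I / V) / (2 ^ k : ℕ) := by
    have : Tendsto (fun k : ℕ => 1 + -(2 * I / V) / ((2 ^ k : ℕ) : ℝ)) atTop (𝓝 (1 + 0)) :=
      ((tendsto_natCast_atTop_atTop.comp
        (tendsto_pow_atTop_atTop_of_one_lt one_lt_two)).const_div_atTop _).const_add 1
    exact (this.eventually (lt_mem_nhds (by norm_num))).mono fun _ h => le_of_lt h
  rw [h0]
  refine le_of_tendsto hlim (hpos.mono fun k hk => ?_)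
  have h1 := (mul_le_mul_of_nonneg_left
    (pow_le_pow_left₀ (mul_nonneg hV0.le hk) (hlow k) (2 ^ k)) hV0.le).trans (hind k)
  rw [mul_pow, mul_left_comm] at h1
  exact le_of_mul_le_mul_left h1 (by positivity)

end LowerBound

section UpperBound

variable {n : ℕ}

lemma hasFDerivAt_mehler {g : (Fin n → ℝ) → ℝ} (hg : BddContDiff g) (θ : ℝ) (x : Fin n → ℝ) :
    HasFDerivAt (mehler (_root_.stdGaussian n) θ g)
      (∫ y, cos θ • fderiv ℝ g (cos θ • x + sin θ • y) ∂_root_.stdGaussian n) x := by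
  obtain ⟨C, hC⟩ := hg.bdd_fderiv
  have hc := hg.contDiff.continuous
  have hdc := hg.contDiff.continuous_fderiv one_ne_zero
  refine hasFDerivAt_integral_of_dominated_of_fderiv_le (bound := fun _ => |cos θ| * C)
    (s := univ) (F' := fun x y => cos θ • fderiv ℝ g (cos θ • x + sin θ • y)) univ_mem
    (Eventually.of_forall fun x => (by fun_prop : Continuous _).aestronglyMeasurable)
    ((hg.bddCont.comp (by fun_prop)).integrable _)
    (by fun_prop : Continuous _).aestronglyMeasurable
    (ae_of_all _ fun y x _ => ?_) (integrable_const _) (ae_of_all _ fun y x _ => ?_)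
  · rw [norm_smul, norm_eq_abs]
    exact mul_le_mul_of_nonneg_left (hC _) (abs_nonneg _)
  · have h1 : HasFDerivAt (fun x : Fin n → ℝ => cos θ • x + sin θ • y)
        (cos θ • ContinuousLinearMap.id ℝ (Fin n → ℝ)) x :=
      ((hasFDerivAt_id x).const_smul (cos θ)).add_const _
    have h2 := ((hg.contDiff.differentiable one_ne_zero _).hasFDerivAt).comp x h1
    rw [ContinuousLinearMap.comp_smul, ContinuousLinearMap.comp_id] at h2
    exact h2

lemma BddContDiff.mehler {g : (Fin n → ℝ) → ℝ} (hg : BddContDiff g) (θ : ℝ) :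
    BddContDiff (mehler (_root_.stdGaussian n) θ g) := by
  obtain ⟨C, hC⟩ := hg.bdd_fderiv
  have hdc := hg.contDiff.continuous_fderiv one_ne_zero
  have hb : ∀ x y, ‖cos θ • fderiv ℝ g (cos θ • x + sin θ • y)‖ ≤ |cos θ| * C := fun x y => by
    rw [norm_smul, norm_eq_abs]
    exact mul_le_mul_of_nonneg_left (hC _) (abs_nonneg _)
  refine ⟨contDiff_one_iff_hasFDerivAt.2 ⟨_, ?_, hasFDerivAt_mehler hg θ⟩,
    (hg.bddCont.mehler θ).2, |cos θ| * C, fun x => ?_⟩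
  · exact continuous_of_dominated (bound := fun _ => |cos θ| * C)
      (fun x => (by fun_prop : Continuous _).aestronglyMeasurable)
      (fun x => ae_of_all _ (hb x)) (integrable_const _) (ae_of_all _ fun y => by fun_prop)
  · rw [(hasFDerivAt_mehler hg θ x).fderiv]
    simpa using norm_integral_le_of_norm_le_const (μ := _root_.stdGaussian n) (ae_of_all _ (hb x))

lemma pderiv_mehler {g : (Fin n → ℝ) → ℝ} (hg : BddContDiff g) (θ : ℝ) (i : Fin n)
    (x : Fin n → ℝ) :
    pderiv (mehler (_root_.stdGaussian n) θ g) i x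
      = cos θ * mehler (_root_.stdGaussian n) θ (pderiv g i) x := by
  obtain ⟨C, hC⟩ := hg.bdd_fderiv
  have hdc := hg.contDiff.continuous_fderiv one_ne_zero
  have hi : Integrable (fun y => cos θ • fderiv ℝ g (cos θ • x + sin θ • y))
      (_root_.stdGaussian n) := by
    refine Integrable.of_bound (by fun_prop : Continuous _).aestronglyMeasurable (|cos θ| * C)
      (ae_of_all _ fun y => ?_)
    rw [norm_smul, norm_eq_abs]
    exact mul_le_mul_of_nonneg_left (hC _) (abs_nonneg _)
  rw [pderiv, (hasFDerivAt_mehler hg θ x).fderiv, ContinuousLinearMap.integral_apply hi,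
    _root_.mehler, ← integral_const_mul]
  rfl

lemma measurePreserving_comp_perm (p : Equiv.Perm (Fin n)) :
    MeasurePreserving (fun x : Fin n → ℝ => x ∘ p)
      (_root_.stdGaussian n) (_root_.stdGaussian n) := by
  have h := measurePreserving_piCongrLeft (α := fun _ : Fin n => ℝ)
    (fun _ => gaussianReal 0 1) p.symm
  rw [_root_.stdGaussian]
  convert h using 1
  ext x i
  have := MeasurableEquiv.piCongrLeft_apply_apply (β := fun _ : Fin n => ℝ) p.symm x (p i)
  simpa using this.symm

lemma pderiv_comp_swap {g : (Fin n → ℝ) → ℝ} (hg : BddContDiff g)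
    (hp : ∀ (p : Equiv.Perm (Fin n)) (x : Fin n → ℝ), g (x ∘ p) = g x) (i j : Fin n)
    (x : Fin n → ℝ) : pderiv g i x = pderiv g j (x ∘ Equiv.swap i j) := by
  set P : (Fin n → ℝ) →L[ℝ] (Fin n → ℝ) :=
    ContinuousLinearMap.pi fun k => ContinuousLinearMap.proj (Equiv.swap i j k) with hP
  have h1 : HasFDerivAt g ((fderiv ℝ g (P x)).comp P) x := by
    have h := ((hg.contDiff.differentiable one_ne_zero (P x)).hasFDerivAt).comp x P.hasFDerivAt
    have e : g ∘ P = g := funext fun y => hp (Equiv.swap i j) y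
    rwa [e] at h
  rw [pderiv, h1.fderiv, ContinuousLinearMap.comp_apply]
  have e : P (Pi.single i 1) = Pi.single j 1 := by
    ext k
    simp only [hP, ContinuousLinearMap.coe_pi', ContinuousLinearMap.proj_apply, Pi.single_apply]
    congr 1
    rw [eq_iff_iff, Equiv.swap_apply_eq_iff, Equiv.swap_apply_left]
  rw [e]
  rfl

lemma integral_comp_pderiv_eq {g : (Fin n → ℝ) → ℝ} (hg : BddContDiff g)
    (hp : ∀ (p : Equiv.Perm (Fin n)) (x : Fin n → ℝ), g (x ∘ p) = g x) {φ : ℝ → ℝ}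
    (hφ : Continuous φ) (i j : Fin n) :
    ∫ x, φ (pderiv g i x) ∂_root_.stdGaussian n = ∫ x, φ (pderiv g j x) ∂_root_.stdGaussian n := by
  have h := measurePreserving_comp_perm (Equiv.swap i j)
  simp_rw [pderiv_comp_swap hg hp i j]
  conv_rhs => rw [← h.map_eq]
  rw [integral_map (f := fun x => φ (pderiv g j x)) h.measurable.aemeasurable
    (hφ.comp (hg.pderiv j).1).measurable.aestronglyMeasurable]

/-- An `L¹`–`L²` inequality for the variance of permutation invariant functions. -/
lemma BddContDiff.card_mul_pow_three_le {g : (Fin n → ℝ) → ℝ} (hg : BddContDiff g)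
    (hp : ∀ (p : Equiv.Perm (Fin n)) (x : Fin n → ℝ), g (x ∘ p) = g x)
    (h0 : ∫ x, g x ∂_root_.stdGaussian n = 0)
    {V I A : ℝ} (hV : V = ∫ x, g x ^ 2 ∂_root_.stdGaussian n) (hV0 : 0 < V)
    (hI : I = ∫ x, ∑ i, _root_.pderiv g i x ^ 2 ∂_root_.stdGaussian n)
    (hA : A = ∫ x, ∑ i, |_root_.pderiv g i x| ∂_root_.stdGaussian n) :
    n * (V * rexp (-(2 * I / V))) ^ 3 ≤ A ^ 2 * I ^ 2 := by
  rcases Nat.eq_zero_or_pos n with rfl | hn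
  · simpa using by positivity
  set a := ∫ x, _root_.mehler (_root_.stdGaussian n) (π / 4) g x ^ 2 ∂_root_.stdGaussian n with ha
  set m : Fin n → ℝ := fun i => ∫ x, _root_.mehler (_root_.stdGaussian n) (π / 4)
    (_root_.pderiv g i) x ^ 2 ∂_root_.stdGaussian n with hm
  have hm0 : ∀ i, 0 ≤ m i := fun i => integral_nonneg fun _ => sq_nonneg _
  have hlow := hg.mul_exp_le_integral_mehler_sq hV hV0 hI
  have hP := (hg.mehler (π / 4)).integral_sq_le (by
    rw [centered_stdGaussian.integral_mehler _ hg.bddCont, h0])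
  simp_rw [pderiv_mehler hg, mul_pow, ← Finset.mul_sum] at hP
  rw [integral_const_mul, integral_finsetSum _ fun i _ =>
    (((hg.pderiv i).mehler _).pow 2).integrable _] at hP
  have hup : a ≤ ∑ i, m i := by
    refine hP.trans ?_
    rw [cos_pi_div_four, div_pow, sq_sqrt zero_le_two, ← mul_assoc]
    have hp : π ^ 2 ≤ 10 := by nlinarith [pi_lt_d2, pi_pos]
    refine mul_le_of_le_one_left (Finset.sum_nonneg fun i _ => hm0 i) ?_
    linarith
  set i₀ : Fin n := ⟨0, hn⟩
  set α := ∫ x, |_root_.pderiv g i₀ x| ∂_root_.stdGaussian n with hα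
  set β := ∫ x, _root_.pderiv g i₀ x ^ 2 ∂_root_.stdGaussian n with hβ
  have hAα : A = n * α := by
    rw [hA, integral_finsetSum _ fun i _ => (hg.pderiv i).abs.integrable _,
      Finset.sum_congr rfl fun i _ => integral_comp_pderiv_eq hg hp continuous_abs i i₀]
    simp [hα]
  have hIβ : I = n * β := by
    rw [hI, integral_finsetSum _ fun i _ => ((hg.pderiv i).pow 2).integrable _,
      Finset.sum_congr rfl fun i _ => integral_comp_pderiv_eq hg hp (continuous_pow 2) i i₀]
    simp [hβ]
  have hm3 : ∀ i, m i ^ 3 ≤ α ^ 2 * β ^ 2 := fun i => by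
    have h := centered_stdGaussian.integral_mehler_sq_pow_three_le (hg.pderiv i)
    rwa [integral_comp_pderiv_eq hg hp continuous_abs i i₀,
      integral_comp_pderiv_eq hg hp (continuous_pow 2) i i₀] at h
  have hsum : (∑ i, m i) ^ 3 ≤ n ^ 2 * (n * (α ^ 2 * β ^ 2)) := by
    have h := pow_sum_div_card_le_sum_pow (s := Finset.univ) (fun i _ => hm0 i) 2
    have hn' : (0 : ℝ) < n ^ 2 := by positivity
    rw [Finset.card_univ, Fintype.card_fin, div_le_iff₀' hn'] at h
    refine h.trans (mul_le_mul_of_nonneg_left ?_ hn'.le)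
    simpa using Finset.sum_le_sum fun i (_ : i ∈ Finset.univ) => hm3 i
  calc n * (V * rexp (-(2 * I / V))) ^ 3 ≤ n * (∑ i, m i) ^ 3 :=
        mul_le_mul_of_nonneg_left (pow_le_pow_left₀ (by positivity) (hlow.trans hup) 3)
          (Nat.cast_nonneg _)
    _ ≤ n * (n ^ 2 * (n * (α ^ 2 * β ^ 2))) :=
        mul_le_mul_of_nonneg_left hsum (Nat.cast_nonneg _)
    _ = A ^ 2 * I ^ 2 := by rw [hAα, hIβ]; ring

end UpperBound

section Laplace

variable {n : ℕ}

lemma BddContDiff.hasFDerivAt_exp {f : (Fin n → ℝ) → ℝ} (hf : BddContDiff f) (l c : ℝ)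
    (x : Fin n → ℝ) :
    HasFDerivAt (fun x => rexp (l * f x) - c) (rexp (l * f x) • l • fderiv ℝ f x) x :=
  (((hf.contDiff.differentiable one_ne_zero x).hasFDerivAt.const_mul l).exp).sub_const c

lemma BddContDiff.exp_sub_const {f : (Fin n → ℝ) → ℝ} (hf : BddContDiff f) (l c : ℝ) :
    BddContDiff fun x => rexp (l * f x) - c := by
  have hb := hf.bddCont.exp_mul l
  refine ⟨((contDiff_const.mul hf.contDiff).exp).sub contDiff_const,
    (hb.sub (BddCont.const c)).2, ?_⟩
  obtain ⟨C, hC⟩ := hf.bdd_fderiv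
  obtain ⟨D, hD⟩ := hb.2
  refine ⟨D * (|l| * C), fun x => ?_⟩
  rw [(hf.hasFDerivAt_exp l c x).fderiv, norm_smul, norm_smul]
  exact mul_le_mul (hD x) (mul_le_mul_of_nonneg_left (hC x) (abs_nonneg _)) (by positivity)
    ((abs_nonneg _).trans (hD x))

lemma BddContDiff.pderiv_exp_sub_const {f : (Fin n → ℝ) → ℝ} (hf : BddContDiff f) (l c : ℝ)
    (i : Fin n) (x : Fin n → ℝ) :
    _root_.pderiv (fun x => rexp (l * f x) - c) i x
      = rexp (l * f x) * (l * _root_.pderiv f i x) := by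
  rw [_root_.pderiv, (hf.hasFDerivAt_exp l c x).fderiv]
  rfl

lemma log_mul_le_of_card_mul_pow_three_le {N V I A J r : ℝ} (hV : 0 < V) (hI0 : 0 ≤ I) (hI : I ≤ J)
    (hr : 0 < r) (hN : 0 < N * r) (hA : A ^ 2 * r ≤ J)
    (h : N * (V * rexp (-(2 * I / V))) ^ 3 ≤ A ^ 2 * I ^ 2) :
    log (N * r) * V ≤ 9 * J := by
  have hJ : 0 ≤ J := hI0.trans hI
  have h1 : N * r * (V * rexp (-(2 * J / V))) ^ 3 ≤ J ^ 3 :=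
    calc N * r * (V * rexp (-(2 * J / V))) ^ 3 ≤ N * r * (V * rexp (-(2 * I / V))) ^ 3 := by gcongr
      _ = r * (N * (V * rexp (-(2 * I / V))) ^ 3) := by ring
      _ ≤ r * (A ^ 2 * I ^ 2) := mul_le_mul_of_nonneg_left h hr.le
      _ = (A ^ 2 * r) * I ^ 2 := by ring
      _ ≤ J * J ^ 2 := by gcongr
      _ = J ^ 3 := by ring
  have h2 : N * r ≤ rexp (9 * J / V) := by
    have hy : J ^ 3 ≤ (V * rexp (J / V)) ^ 3 := by
      refine pow_le_pow_left₀ hJ ?_ 3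
      have := add_one_le_exp (J / V)
      rw [← div_le_iff₀' hV]
      linarith
    have hpos : 0 < (V * rexp (-(2 * J / V))) ^ 3 := by positivity
    refine le_of_mul_le_mul_right (h1.trans (hy.trans (le_of_eq ?_))) hpos
    rw [mul_pow, mul_pow, ← exp_nat_mul, ← exp_nat_mul, mul_left_comm, ← exp_add]
    congr 2
    push_cast
    ring
  rw [← le_div_iff₀ hV]
  exact (log_le_log hN h2).trans (log_exp _).le

/-- A self-improving bound for the Laplace transform of a permutation invariant function. -/
lemma BddContDiff.log_mul_laplace_sub_le {f : (Fin n → ℝ) → ℝ} (hf : BddContDiff f)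
    (hp : ∀ (p : Equiv.Perm (Fin n)) (x : Fin n → ℝ), f (x ∘ p) = f x) {a b : ℝ} (ha : 0 < a)
    (hb : 0 < b) (h1 : ∀ x, ∑ i, |_root_.pderiv f i x| ≤ a)
    (h2 : ∀ x, ∑ i, _root_.pderiv f i x ^ 2 ≤ b ^ 2) (hL : 0 < log (n * b ^ 2 / a ^ 2)) (l : ℝ) :
    log (n * b ^ 2 / a ^ 2) * (∫ x, rexp (l * f x) ∂_root_.stdGaussian n
        - (∫ x, rexp (l / 2 * f x) ∂_root_.stdGaussian n) ^ 2)
      ≤ 9 * (l ^ 2 / 4 * b ^ 2 * ∫ x, rexp (l * f x) ∂_root_.stdGaussian n) := by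
  set P := ∫ x, rexp (l * f x) ∂_root_.stdGaussian n with hP
  set Q := ∫ x, rexp (l / 2 * f x) ∂_root_.stdGaussian n with hQ
  have hP0 : 0 ≤ P := integral_nonneg fun _ => (exp_pos _).le
  have hQ0 : 0 ≤ Q := integral_nonneg fun _ => (exp_pos _).le
  rcases le_or_gt (P - Q ^ 2) 0 with hV | hV
  · exact (mul_nonpos_of_nonneg_of_nonpos hL.le hV).trans (by positivity)
  have hbl := hf.bddCont.exp_mul l
  have hbh := hf.bddCont.exp_mul (l / 2)
  have hsq : ∀ x, rexp (l / 2 * f x) ^ 2 = rexp (l * f x) := fun x => by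
    rw [← exp_nat_mul]; push_cast; ring_nf
  have hg := hf.exp_sub_const (l / 2) Q
  have hV' : P - Q ^ 2 = ∫ x, (rexp (l / 2 * f x) - Q) ^ 2 ∂_root_.stdGaussian n := by
    simp_rw [sub_sq, hsq]
    rw [integral_add ((hbl.sub (((BddCont.const 2).mul hbh).mul (BddCont.const Q))).integrable _)
      (integrable_const _), integral_sub (hbl.integrable _)
      (((hbh.integrable _).const_mul 2).mul_const Q), integral_mul_const, integral_const_mul]
    simp [← hP, ← hQ]
    ring
  have hI : ∫ x, ∑ i, _root_.pderiv (fun x => rexp (l / 2 * f x) - Q) i x ^ 2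
      ∂_root_.stdGaussian n ≤ l ^ 2 / 4 * b ^ 2 * P := by
    rw [hP, ← integral_const_mul]
    refine integral_mono (hg.sum_pderiv_sq.integrable _) ((hbl.integrable _).const_mul _)
      fun x => ?_
    simp only [hf.pderiv_exp_sub_const, mul_pow, hsq, ← Finset.mul_sum]
    have := mul_le_mul_of_nonneg_left (h2 x) (by positivity : 0 ≤ rexp (l * f x) * (l ^ 2 / 4))
    linarith
  have hA : ∫ x, ∑ i, |_root_.pderiv (fun x => rexp (l / 2 * f x) - Q) i x|
      ∂_root_.stdGaussian n ≤ |l| / 2 * a * Q := by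
    rw [hQ, ← integral_const_mul]
    refine integral_mono ((BddCont.sum fun i => (hg.pderiv i).abs).integrable _)
      ((hbh.integrable _).const_mul _) fun x => ?_
    simp only [hf.pderiv_exp_sub_const, abs_mul, abs_exp, ← Finset.mul_sum]
    rw [abs_div, abs_two]
    have := mul_le_mul_of_nonneg_left (h1 x) (by positivity : 0 ≤ rexp (l / 2 * f x) * (|l| / 2))
    linarith
  have hA0 : 0 ≤ ∫ x, ∑ i, |_root_.pderiv (fun x => rexp (l / 2 * f x) - Q) i x|
      ∂_root_.stdGaussian n := integral_nonneg fun _ => Finset.sum_nonneg fun _ _ => abs_nonneg _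
  have h0 : ∫ x, (rexp (l / 2 * f x) - Q) ∂_root_.stdGaussian n = 0 := by
    rw [integral_sub (hbh.integrable _) (integrable_const _)]
    simp [hQ]
  have hmain := hg.card_mul_pow_three_le (fun p x => by simp only [hp]) h0 hV' hV rfl rfl
  rw [mul_div_assoc] at hL ⊢
  have hn : (0 : ℝ) < n * (b ^ 2 / a ^ 2) := by
    rcases Nat.eq_zero_or_pos n with rfl | hn
    · simp at hL
    · positivity
  refine log_mul_le_of_card_mul_pow_three_le hV
    (integral_nonneg fun _ => Finset.sum_nonneg fun _ _ => sq_nonneg _) hI (by positivity) hn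
    ?_ hmain
  calc _ ≤ (|l| / 2 * a * Q) ^ 2 * (b ^ 2 / a ^ 2) := by gcongr
    _ = l ^ 2 / 4 * b ^ 2 * Q ^ 2 := by
      rw [mul_pow, mul_pow, div_pow, sq_abs]
      field_simp
      ring
    _ ≤ l ^ 2 / 4 * b ^ 2 * P := by
      have : Q ^ 2 ≤ P := by linarith
      gcongr

lemma le_exp_mul_of_forall_sub_le {Φ : ℝ → ℝ} (hΦ : ∀ l, 0 < Φ l) {κ m D : ℝ} (hκ : 0 ≤ κ)
    (h : ∀ l, Φ l - Φ (l / 2) ^ 2 ≤ κ * l ^ 2 * Φ l)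
    (hexp : ∀ l, Φ l ≤ rexp (l * m) * rexp (l ^ 2 * D)) {l : ℝ} (hl : κ * l ^ 2 ≤ 1 / 2) :
    Φ l ≤ rexp (4 * (κ * l ^ 2) + l * m) := by
  have hstep : ∀ r, κ * r ^ 2 ≤ 1 / 2 → Φ r ≤ rexp (2 * (κ * r ^ 2)) * Φ (r / 2) ^ 2 := by
    intro r hr
    have hs0 : 0 ≤ κ * r ^ 2 := by positivity
    have h1 : (1 - κ * r ^ 2) * Φ r ≤ Φ (r / 2) ^ 2 := by linarith [h r]
    have h2 : 1 ≤ rexp (2 * (κ * r ^ 2)) * (1 - κ * r ^ 2) := by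
      nlinarith [add_one_le_exp (2 * (κ * r ^ 2))]
    calc Φ r ≤ rexp (2 * (κ * r ^ 2)) * (1 - κ * r ^ 2) * Φ r :=
          le_mul_of_one_le_left (hΦ r).le h2
      _ = rexp (2 * (κ * r ^ 2)) * ((1 - κ * r ^ 2) * Φ r) := by ring
      _ ≤ _ := mul_le_mul_of_nonneg_left h1 (exp_pos _).le
  have hiter : ∀ k : ℕ, Φ l ≤ rexp (4 * (κ * l ^ 2) * (1 - 1 / 2 ^ k)) * Φ (l / 2 ^ k) ^ 2 ^ k := by
    intro k
    induction k with
    | zero => simp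
    | succ k ih =>
      have hk : κ * (l / 2 ^ k) ^ 2 ≤ 1 / 2 := by
        refine le_trans ?_ hl
        rw [div_pow]
        refine mul_le_mul_of_nonneg_left (div_le_self (sq_nonneg _) ?_) hκ
        exact one_le_pow₀ (one_le_pow₀ one_le_two)
      refine ih.trans ?_
      refine (mul_le_mul_of_nonneg_left (pow_le_pow_left₀ (hΦ _).le (hstep _ hk) _)
        (exp_pos _).le).trans (le_of_eq ?_)
      rw [mul_pow, ← exp_nat_mul, ← mul_assoc, ← exp_add, ← pow_mul, ← pow_succ', div_div,
        ← pow_succ]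
      congr 2
      push_cast
      field_simp
      ring
  have hbound : ∀ k : ℕ, Φ l ≤ rexp (4 * (κ * l ^ 2) + l * m + l ^ 2 * D / 2 ^ k
      - 4 * (κ * l ^ 2) / 2 ^ k) := by
    intro k
    refine (hiter k).trans ?_
    refine (mul_le_mul_of_nonneg_left (pow_le_pow_left₀ (hΦ _).le (hexp _) _)
      (exp_pos _).le).trans (le_of_eq ?_)
    rw [← exp_add, ← exp_nat_mul, ← exp_add]
    congr 1
    push_cast
    field_simp
    ring
  have hinv : ∀ c : ℝ, Tendsto (fun k : ℕ => c / 2 ^ k) atTop (𝓝 0) := fun c =>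
    (tendsto_pow_atTop_atTop_of_one_lt one_lt_two).const_div_atTop c
  have hlim : Tendsto (fun k : ℕ => rexp (4 * (κ * l ^ 2) + l * m + l ^ 2 * D / 2 ^ k
      - 4 * (κ * l ^ 2) / 2 ^ k)) atTop (𝓝 (rexp (4 * (κ * l ^ 2) + l * m + 0 - 0))) :=
    (continuous_exp.tendsto _).comp (((hinv _).const_add _).sub (hinv _))
  simpa using ge_of_tendsto' hlim hbound

end Laplace

section Tail

variable {n : ℕ}

lemma measure_lt_abs_sub_le {X : Type*} [MeasurableSpace X] [TopologicalSpace X] [BorelSpace X]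
    (μ : Measure X) [IsProbabilityMeasure μ] {f : X → ℝ} (hf : BddCont f) {l K m : ℝ} (hl : 0 ≤ l)
    (h1 : ∫ x, rexp (l * f x) ∂μ ≤ rexp (K + l * m))
    (h2 : ∫ x, rexp (-l * f x) ∂μ ≤ rexp (K + -l * m)) (t : ℝ) :
    μ.real {x | t < |f x - m|} ≤ 2 * rexp (K - l * t) := by
  have hsub : {x | t < |f x - m|} ⊆ {x | m + t ≤ f x} ∪ {x | f x ≤ m - t} := by
    intro x hx
    rcases lt_abs.1 (mem_ofPred.1 hx) with h | h
    · left; simp only [mem_ofPred_eq]; linarith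
    · right; simp only [mem_ofPred_eq]; linarith
  have e1 := measure_ge_le_exp_mul_mgf (μ := μ) (X := f) (m + t) hl ((hf.exp_mul l).integrable μ)
  have e2 := measure_le_le_exp_mul_mgf (μ := μ) (X := f) (m - t) (neg_nonpos.2 hl)
    ((hf.exp_mul (-l)).integrable μ)
  have e1' := e1.trans (mul_le_mul_of_nonneg_left h1 (exp_pos _).le)
  have e2' := e2.trans (mul_le_mul_of_nonneg_left h2 (exp_pos _).le)
  rw [← exp_add] at e1' e2'
  have a1 : -l * (m + t) + (K + l * m) = K - l * t := by ring
  have a2 : - -l * (m - t) + (K + -l * m) = K - l * t := by ring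
  rw [a1] at e1'
  rw [a2] at e2'
  calc _ ≤ _ := measureReal_mono hsub
    _ ≤ _ := measureReal_union_le _ _
    _ ≤ _ := by linarith

lemma le_four_mul_exp_of_le {p K s : ℝ} (hp : p ≤ 1) (hK : K ≤ 2) (h : p ≤ 2 * rexp (K - s)) :
    p ≤ 4 * rexp (-(s / 2)) := by
  rcases le_or_gt (1 / 4) (rexp (-(s / 2))) with h1 | h1
  · linarith
  have e : rexp (K - s) = rexp K * (rexp (-(s / 2)) * rexp (-(s / 2))) := by
    rw [← exp_add, ← exp_add]; ring_nf
  have hK8 : rexp K ≤ 8 := by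
    refine (exp_le_exp.2 hK).trans ?_
    have h2 : rexp 2 = rexp 1 * rexp 1 := by rw [← exp_add]; norm_num
    rw [h2]
    nlinarith [exp_one_lt_d9, exp_pos 1]
  have hpos := exp_pos (-(s / 2))
  have h2 : rexp (-(s / 2)) * rexp (-(s / 2)) ≤ rexp (-(s / 2)) * (1 / 4) :=
    mul_le_mul_of_nonneg_left h1.le hpos.le
  have h3 : rexp K * (rexp (-(s / 2)) * rexp (-(s / 2))) ≤ 8 * (rexp (-(s / 2)) * (1 / 4)) :=
    mul_le_mul hK8 h2 (by positivity) (by norm_num)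
  rw [e] at h
  linarith

/-- Concentration for smooth permutation invariant functions. -/
lemma BddContDiff.measure_lt_abs_sub_le {f : (Fin n → ℝ) → ℝ} (hf : BddContDiff f)
    (hp : ∀ (p : Equiv.Perm (Fin n)) (x : Fin n → ℝ), f (x ∘ p) = f x) {a b : ℝ} (ha : 0 < a)
    (hb : 0 < b) (h1 : ∀ x, ∑ i, |_root_.pderiv f i x| ≤ a)
    (h2 : ∀ x, ∑ i, _root_.pderiv f i x ^ 2 ≤ b ^ 2) {t : ℝ} (ht : 0 < t) :
    (_root_.stdGaussian n).real {x | t < |f x - ∫ y, f y ∂_root_.stdGaussian n|}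
      ≤ 4 * rexp (-(1 / 5) * max (t ^ 2 / b ^ 2) (t / b * √(log (n * b ^ 2 / a ^ 2)))) := by
  set m := ∫ y, f y ∂_root_.stdGaussian n with hm
  have hbc := hf.bddCont
  have hexp : ∀ l : ℝ, ∫ x, rexp (l * f x) ∂_root_.stdGaussian n
      ≤ rexp (l * m) * rexp (l ^ 2 * (5 / 4 * b ^ 2)) := fun l => by
    refine (hf.integral_exp_le h2 l).trans ?_
    have hπ : π ^ 2 ≤ 10 := by nlinarith [pi_lt_d2, pi_pos]
    have := mul_le_mul_of_nonneg_left hπ (by positivity : 0 ≤ l ^ 2 * b ^ 2 / 8)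
    refine mul_le_mul_of_nonneg_left (exp_le_exp.2 ?_) (exp_pos _).le
    linarith
  have hgauss : (_root_.stdGaussian n).real {x | t < |f x - m|}
      ≤ 4 * rexp (-(1 / 5) * (t ^ 2 / b ^ 2)) := by
    set l : ℝ := 2 * t / (5 * b ^ 2) with hl
    have hK : ∀ r : ℝ, r ^ 2 = l ^ 2 → ∫ x, rexp (r * f x) ∂_root_.stdGaussian n
        ≤ rexp (t ^ 2 / (5 * b ^ 2) + r * m) := fun r hr => by
      refine (hexp r).trans (le_of_eq ?_)
      rw [← exp_add, hr, add_comm, hl]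
      congr 2
      field_simp
      norm_num
    refine (_root_.measure_lt_abs_sub_le _ hbc (by positivity : 0 ≤ l) (hK l rfl)
      (hK (-l) (neg_sq l)) t).trans ?_
    have e : t ^ 2 / (5 * b ^ 2) - l * t = -(1 / 5) * (t ^ 2 / b ^ 2) := by
      rw [hl]
      field_simp
      ring
    rw [e]
    linarith [exp_pos (-(1 / 5) * (t ^ 2 / b ^ 2))]
  rcases le_total (t / b * √(log (n * b ^ 2 / a ^ 2))) (t ^ 2 / b ^ 2) with h | h
  · rwa [max_eq_left h]
  rw [max_eq_right h]
  set L := log (n * b ^ 2 / a ^ 2) with hL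
  have hL0 : 0 < L := by
    by_contra hc
    rw [sqrt_eq_zero'.2 (not_lt.1 hc), mul_zero] at h
    exact absurd h (not_le.2 (by positivity))
  set l : ℝ := 2 / 5 * √L / b with hl
  have hl2 : 9 * b ^ 2 / (4 * L) * l ^ 2 = 9 / 25 := by
    rw [hl, div_pow, mul_pow, sq_sqrt hL0.le]
    field_simp
    norm_num
  have hK : ∀ r : ℝ, r ^ 2 = l ^ 2 → ∫ x, rexp (r * f x) ∂_root_.stdGaussian n
      ≤ rexp (4 * (9 / 25) + r * m) := fun r hr => by
    rw [← hl2, ← hr]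
    refine le_exp_mul_of_forall_sub_le (Φ := fun r => ∫ x, rexp (r * f x) ∂_root_.stdGaussian n)
      (fun r => integral_exp_pos ((hbc.exp_mul r).integrable _)) (by positivity) (fun r => ?_) hexp
      (by rw [hr, hl2]; norm_num)
    have := hf.log_mul_laplace_sub_le hp ha hb h1 h2 hL0 r
    rw [← hL, ← le_div_iff₀' hL0] at this
    refine this.trans (le_of_eq ?_)
    field_simp
  have := le_four_mul_exp_of_le measureReal_le_one (by norm_num)
    (_root_.measure_lt_abs_sub_le _ hbc (by positivity : 0 ≤ l) (hK l rfl) (hK (-l) (neg_sq l)) t)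
  refine this.trans (le_of_eq ?_)
  rw [hl]
  congr 2
  ring

end Tail

section Approximation

variable {n : ℕ}

lemma abs_fderiv_le_of_forall_abs_sub_le {h : (Fin n → ℝ) → ℝ} {q : (Fin n → ℝ) → ℝ}
    {x : Fin n → ℝ} (hd : DifferentiableAt ℝ h x) (hq : ∀ (s : ℝ) v, q (s • v) = |s| * q v)
    (hq0 : ∀ v, 0 ≤ q v) (hh : ∀ x y, |h x - h y| ≤ q (x - y)) (v : Fin n → ℝ) :
    |fderiv ℝ h x v| ≤ q v := by
  have h1 : HasDerivAt (fun s : ℝ => x + s • v) v 0 := by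
    simpa using ((hasDerivAt_id (0 : ℝ)).smul_const v).const_add x
  have h2 : HasDerivAt (fun s : ℝ => h (x + s • v)) (fderiv ℝ h x v) 0 := by
    refine HasFDerivAt.comp_hasDerivAt (l := h) 0 ?_ h1
    simpa using hd.hasFDerivAt
  refine h2.le_of_lip' (hq0 v) (Eventually.of_forall fun s => ?_)
  rw [norm_eq_abs]
  refine (hh _ _).trans (le_of_eq ?_)
  rw [zero_smul, add_zero, add_sub_cancel_left, hq, sub_zero, norm_eq_abs, mul_comm]

lemma sum_abs_pderiv_le {h : (Fin n → ℝ) → ℝ} (hd : Differentiable ℝ h) {a : ℝ} (ha : 0 ≤ a)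
    (hh : ∀ x y, |h x - h y| ≤ a * ‖x - y‖) (x : Fin n → ℝ) : ∑ i, |pderiv h i x| ≤ a := by
  have h1 := abs_fderiv_le_of_forall_abs_sub_le (hd x) (q := fun v => a * ‖v‖)
    (fun s v => by rw [norm_smul, norm_eq_abs]; ring) (fun v => by positivity) hh
    (fun i => SignType.sign (pderiv h i x))
  have h2 : ‖fun i => ((SignType.sign (pderiv h i x) : SignType) : ℝ)‖ ≤ 1 :=
    (pi_norm_le_iff_of_nonneg zero_le_one).2 fun i => by
      cases SignType.sign (pderiv h i x) <;> simp
  rw [strongDual_apply_eq_sum] at h1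
  calc ∑ i, |pderiv h i x|
      = ∑ i, (SignType.sign (pderiv h i x) : ℝ) * fderiv ℝ h x (Pi.single i 1) :=
        Finset.sum_congr rfl fun i _ => (sign_mul_self _).symm
    _ ≤ _ := (le_abs_self _).trans h1
    _ ≤ a := mul_le_of_le_one_right ha h2

lemma sum_pderiv_sq_le {h : (Fin n → ℝ) → ℝ} (hd : Differentiable ℝ h) {b : ℝ} (hb : 0 ≤ b)
    (hh : ∀ x y, |h x - h y| ≤ b * euclNorm (x - y)) (x : Fin n → ℝ) :
    ∑ i, pderiv h i x ^ 2 ≤ b ^ 2 := by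
  have h1 := abs_fderiv_le_of_forall_abs_sub_le (hd x) (q := fun v => b * euclNorm v)
    (fun s v => by
      have : euclNorm (s • v) = |s| * euclNorm v := by
        simp only [euclNorm, Pi.smul_apply, smul_eq_mul, mul_pow, ← Finset.mul_sum]
        rw [sqrt_mul (sq_nonneg s), sqrt_sq_eq_abs]
      rw [this]; ring) (fun v => mul_nonneg hb (sqrt_nonneg _)) hh (fun i => pderiv h i x)
  rw [strongDual_apply_eq_sum] at h1
  set S := ∑ i, pderiv h i x ^ 2 with hS
  have hS0 : 0 ≤ S := Finset.sum_nonneg fun i _ => sq_nonneg _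
  have e : ∑ i, pderiv h i x * fderiv ℝ h x (Pi.single i 1) = S :=
    Finset.sum_congr rfl fun i _ => (sq _).symm
  rw [e, abs_of_nonneg hS0] at h1
  have h2 : S ≤ b * √S := h1
  have h3 := mul_self_sqrt hS0
  have h4 : √S ≤ b := by
    rcases (sqrt_nonneg S).eq_or_lt with h | h
    · rw [← h]; exact hb
    · exact le_of_mul_le_mul_right (h3.le.trans h2) h
  nlinarith [sqrt_nonneg S]

/-- Lipschitz functions, with respect to arbitrary gauges, can be mollified. -/
lemma exists_contDiff_abs_sub_le {u : (Fin n → ℝ) → ℝ} (hu : Continuous u) {ε δ : ℝ} (hδ : 0 < δ)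
    (hε : ∀ x y, dist x y < δ → |u x - u y| ≤ ε) :
    ∃ h : (Fin n → ℝ) → ℝ, ContDiff ℝ 1 h ∧ (∀ x, |h x - u x| ≤ ε) ∧
      ∀ q : (Fin n → ℝ) → ℝ, (∀ x y, |u x - u y| ≤ q (x - y)) → ∀ x y, |h x - h y| ≤ q (x - y) := by
  let φ : ContDiffBump (0 : Fin n → ℝ) := ⟨δ / 2, δ, half_pos hδ, half_lt_self hδ⟩
  have hφc : Continuous (φ.normed volume) := φ.continuous_normed
  have hint : ∀ w : (Fin n → ℝ) → ℝ, Continuous w →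
      Integrable (fun s => φ.normed volume s * w s) volume := fun w hw =>
    (hφc.mul hw).integrable_of_hasCompactSupport φ.hasCompactSupport_normed.mul_right
  refine ⟨convolution (φ.normed volume) u (ContinuousLinearMap.lsmul ℝ ℝ) volume, ?_, fun x => ?_,
    fun q hq x y => ?_⟩
  · exact φ.hasCompactSupport_normed.contDiff_convolution_left _ φ.contDiff_normed
      hu.locallyIntegrable
  · exact φ.dist_normed_convolution_le hu.aestronglyMeasurable fun y hy => hε y x hy
  · simp only [convolution_def, ContinuousLinearMap.lsmul_apply, smul_eq_mul]
    rw [← integral_sub (hint _ (by fun_prop)) (hint _ (by fun_prop))]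
    calc _ ≤ ∫ s, φ.normed volume s * q (x - y) := by
          rw [← norm_eq_abs]
          refine norm_integral_le_of_norm_le (φ.integrable_normed.mul_const _)
            (ae_of_all _ fun s => ?_)
          rw [← mul_sub, norm_mul, norm_eq_abs, norm_eq_abs, abs_of_nonneg (φ.nonneg_normed s)]
          refine mul_le_mul_of_nonneg_left ?_ (φ.nonneg_normed s)
          simpa using hq (x - s) (y - s)
      _ = q (x - y) := by rw [integral_mul_const, φ.integral_normed, one_mul]

lemma abs_sum_perm_div_le {c : Equiv.Perm (Fin n) → ℝ} {r : ℝ} (hc : ∀ p, |c p| ≤ r) :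
    |(∑ p, c p) / Fintype.card (Equiv.Perm (Fin n))| ≤ r := by
  have hN : (0 : ℝ) < Fintype.card (Equiv.Perm (Fin n)) := Nat.cast_pos.2 Fintype.card_pos
  rw [abs_div, abs_of_pos hN, div_le_iff₀' hN]
  refine (Finset.abs_sum_le_sum_abs _ _).trans ((Finset.sum_le_sum fun p _ => hc p).trans ?_)
  simp

lemma euclNorm_comp_perm (p : Equiv.Perm (Fin n)) (x : Fin n → ℝ) :
    euclNorm (x ∘ p) = euclNorm x := by
  simp only [euclNorm, Function.comp_apply]
  rw [Equiv.sum_comp p fun i => x i ^ 2]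

lemma norm_comp_perm (p : Equiv.Perm (Fin n)) (x : Fin n → ℝ) : ‖x ∘ p‖ = ‖x‖ := by
  have h : ∀ (p : Equiv.Perm (Fin n)) (x : Fin n → ℝ), ‖x ∘ p‖ ≤ ‖x‖ := fun p x =>
    (pi_norm_le_iff_of_nonneg (norm_nonneg _)).2 fun i => norm_le_pi_norm x (p i)
  refine le_antisymm (h p x) ?_
  have := h p.symm (x ∘ p)
  rwa [Function.comp_assoc, Equiv.self_comp_symm, Function.comp_id] at this

/-- Smooth approximation preserving permutation invariance and both Lipschitz constants. -/
lemma exists_bddContDiff_approx {u : (Fin n → ℝ) → ℝ} {a b : ℝ} (ha : 0 < a) (hb : 0 < b)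
    (hp : ∀ (p : Equiv.Perm (Fin n)) (x : Fin n → ℝ), u (x ∘ p) = u x)
    (hub : ∀ x y, |u x - u y| ≤ b * euclNorm (x - y)) (hua : ∀ x y, |u x - u y| ≤ a * ‖x - y‖)
    {C : ℝ} (hC : ∀ x, |u x| ≤ C) {δ : ℝ} (hδ : 0 < δ) :
    ∃ g : (Fin n → ℝ) → ℝ, BddContDiff g ∧
      (∀ (p : Equiv.Perm (Fin n)) (x : Fin n → ℝ), g (x ∘ p) = g x) ∧
      (∀ x, ∑ i, |pderiv g i x| ≤ a) ∧ (∀ x, ∑ i, pderiv g i x ^ 2 ≤ b ^ 2) ∧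
      ∀ x, |g x - u x| ≤ a * δ := by
  have huc : Continuous u := (LipschitzWith.of_dist_le_mul (K := ⟨a, ha.le⟩) fun x y => by
    rw [dist_eq_norm, dist_eq_norm]; exact hua x y).continuous
  obtain ⟨h, hh, hhu, hhq⟩ := exists_contDiff_abs_sub_le huc hδ (ε := a * δ) fun x y hxy =>
    (hua x y).trans (mul_le_mul_of_nonneg_left (by rw [← dist_eq_norm]; exact hxy.le) ha.le)
  have hhb := hhq (fun v => b * euclNorm v) hub
  have hha := hhq (fun v => a * ‖v‖) hua
  set N : ℝ := ((Fintype.card (Equiv.Perm (Fin n)) : ℕ) : ℝ) with hN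
  have hN0 : N ≠ 0 := Nat.cast_ne_zero.2 Fintype.card_ne_zero
  set g : (Fin n → ℝ) → ℝ := fun x => (∑ p : Equiv.Perm (Fin n), h (x ∘ p)) / N with hg
  have hsub : ∀ x y, g x - g y = (∑ p : Equiv.Perm (Fin n), (h (x ∘ p) - h (y ∘ p))) / N :=
    fun x y => by rw [Finset.sum_sub_distrib, sub_div]
  have hgb : ∀ x y, |g x - g y| ≤ b * euclNorm (x - y) := fun x y => by
    rw [hsub]
    refine abs_sum_perm_div_le fun p => (hhb _ _).trans (le_of_eq ?_)
    rw [← euclNorm_comp_perm p (x - y)]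
    rfl
  have hga : ∀ x y, |g x - g y| ≤ a * ‖x - y‖ := fun x y => by
    rw [hsub]
    refine abs_sum_perm_div_le fun p => (hha _ _).trans (le_of_eq ?_)
    rw [← norm_comp_perm p (x - y)]
    rfl
  have hgu : ∀ x, |g x - u x| ≤ a * δ := fun x => by
    have e : g x - u x = (∑ p : Equiv.Perm (Fin n), (h (x ∘ p) - u (x ∘ p))) / N := by
      simp_rw [hp]
      rw [Finset.sum_sub_distrib, sub_div]
      congr 1
      rw [Finset.sum_const, Finset.card_univ, nsmul_eq_mul, ← hN]
      field_simp
    rw [e]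
    exact abs_sum_perm_div_le fun p => hhu _
  have hgc : ContDiff ℝ 1 g :=
    (ContDiff.sum fun p _ => hh.comp (contDiff_pi.2 fun i => contDiff_apply ℝ ℝ (p i))).div_const N
  have hgd := hgc.differentiable one_ne_zero
  refine ⟨g, ⟨hgc, ⟨C + a * δ, fun x => ?_⟩, ⟨a, fun x => ?_⟩⟩, fun p x => ?_,
    sum_abs_pderiv_le hgd ha.le hga, sum_pderiv_sq_le hgd hb.le hgb, hgu⟩
  · calc |g x| = |(g x - u x) + u x| := by rw [sub_add_cancel]
      _ ≤ |g x - u x| + |u x| := abs_add_le _ _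
      _ ≤ C + a * δ := by linarith [hgu x, hC x]
  · exact norm_fderiv_le_of_lipschitz ℝ (C := ⟨a, ha.le⟩)
      (LipschitzWith.of_dist_le_mul fun x y => by rw [dist_eq_norm, dist_eq_norm]; exact hga x y)
  · simp only [hg]
    congr 1
    exact Fintype.sum_equiv (Equiv.mulLeft p) _ _ fun σ => rfl

end Approximation

section Limit

variable {n : ℕ}

lemma abs_max_neg_min_sub_le (k r s : ℝ) : |max (-k) (min k r) - max (-k) (min k s)| ≤ |r - s| :=
  (abs_max_sub_max_le_max _ _ _ _).trans (by
    rw [sub_self, abs_zero, max_eq_right (abs_nonneg _)]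
    refine (abs_min_sub_min_le_max _ _ _ _).trans ?_
    rw [sub_self, abs_zero, max_eq_right (abs_nonneg _)])

lemma abs_max_neg_min_le_left {k : ℝ} (hk : 0 ≤ k) (r : ℝ) : |max (-k) (min k r)| ≤ k :=
  abs_le.2 ⟨le_max_left _ _, max_le (by linarith) (min_le_left _ _)⟩

lemma max_neg_min_eq_self {k r : ℝ} (h : |r| ≤ k) : max (-k) (min k r) = r := by
  obtain ⟨h1, h2⟩ := abs_le.1 h
  rw [min_eq_right h2, max_eq_right h1]

lemma abs_max_neg_min_le_right {k : ℝ} (hk : 0 ≤ k) (r : ℝ) : |max (-k) (min k r)| ≤ |r| := by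
  have h := abs_max_neg_min_sub_le k r 0
  rwa [max_neg_min_eq_self (r := 0) (by simpa using hk), sub_zero, sub_zero] at h

lemma measureReal_lt_abs_sub_integral_le_of_tendsto {X : Type*} [MeasurableSpace X] (μ : Measure X)
    [IsProbabilityMeasure μ] {F : ℕ → X → ℝ} {f w : X → ℝ}
    (hF : ∀ k, AEStronglyMeasurable (F k) μ) (hw : Integrable w μ) (hFw : ∀ k x, |F k x| ≤ w x)
    (hlim : ∀ x, Tendsto (fun k => F k x) atTop (𝓝 (f x))) {t B : ℝ}
    (hB : ∀ k, μ.real {x | t < |F k x - ∫ y, F k y ∂μ|} ≤ B) :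
    μ {x | t < |f x - ∫ y, f y ∂μ|} ≤ ENNReal.ofReal B := by
  have hm : Tendsto (fun k => ∫ y, F k y ∂μ) atTop (𝓝 (∫ y, f y ∂μ)) :=
    tendsto_integral_of_dominated_convergence w hF hw (fun k => ae_of_all _ (hFw k))
      (ae_of_all _ hlim)
  set T : ℕ → Set X := fun N => ⋂ k ≥ N, {x | t < |F k x - ∫ y, F k y ∂μ|} with hT
  have hmono : Monotone T := fun N M hNM x hx => by
    simp only [hT, mem_iInter] at hx ⊢
    exact fun k hk => hx k (hNM.trans hk)
  have hsub : {x | t < |f x - ∫ y, f y ∂μ|} ⊆ ⋃ N, T N := by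
    intro x (hx : t < |f x - ∫ y, f y ∂μ|)
    obtain ⟨N, hN⟩ := eventually_atTop.1 (((hlim x).sub hm).abs.eventually (lt_mem_nhds hx))
    simp only [hT, mem_iUnion, mem_iInter]
    exact ⟨N, hN⟩
  refine (measure_mono hsub).trans ?_
  rw [hmono.measure_iUnion]
  refine iSup_le fun N => ?_
  refine (measure_mono (iInter₂_subset N le_rfl)).trans ?_
  rw [← ofReal_measureReal]
  exact ENNReal.ofReal_le_ofReal (hB N)

lemma measure_lt_abs_sub_le_of_perm_invariant {f : (Fin n → ℝ) → ℝ} {a b : ℝ} (ha : 0 < a)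
    (hb : 0 < b) (hp : ∀ (p : Equiv.Perm (Fin n)) (x : Fin n → ℝ), f (x ∘ p) = f x)
    (hfb : ∀ x y, |f x - f y| ≤ b * euclNorm (x - y)) (hfa : ∀ x y, |f x - f y| ≤ a * ‖x - y‖)
    {t : ℝ} (ht : 0 < t) :
    _root_.stdGaussian n {x | t < |f x - ∫ y, f y ∂_root_.stdGaussian n|}
      ≤ ENNReal.ofReal
        (4 * rexp (-(1 / 5) * max (t ^ 2 / b ^ 2) (t / b * √(log (n * b ^ 2 / a ^ 2))))) := by
  have happrox : ∀ k : ℕ, ∃ g : (Fin n → ℝ) → ℝ, BddContDiff g ∧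
      (∀ (p : Equiv.Perm (Fin n)) (x : Fin n → ℝ), g (x ∘ p) = g x) ∧
      (∀ x, ∑ i, |pderiv g i x| ≤ a) ∧ (∀ x, ∑ i, pderiv g i x ^ 2 ≤ b ^ 2) ∧
      ∀ x, |g x - max (-(k : ℝ)) (min k (f x))| ≤ a * (1 / (k + 1)) := fun k =>
    exists_bddContDiff_approx ha hb (fun p x => by rw [hp])
      (fun x y => (abs_max_neg_min_sub_le _ _ _).trans (hfb x y))
      (fun x y => (abs_max_neg_min_sub_le _ _ _).trans (hfa x y))
      (fun x => abs_max_neg_min_le_left (Nat.cast_nonneg k) _) (by positivity)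
  choose F hF hFp hFa hFb hFf using happrox
  refine measureReal_lt_abs_sub_integral_le_of_tendsto _ (F := F)
    (w := fun x => |f 0| + a * ‖x‖ + a)
    (fun k => (hF k).contDiff.continuous.measurable.aestronglyMeasurable) ?_ (fun k x => ?_)
    (fun x => ?_) (fun k => (hF k).measure_lt_abs_sub_le (hFp k) ha hb (hFa k) (hFb k) ht)
  · have h : Integrable (fun x : Fin n → ℝ => ‖x‖) (_root_.stdGaussian n) :=
      IsGaussian.integrable_fun_id.norm
    exact ((integrable_const _).add (h.const_mul a)).add (integrable_const _)
  · have h1 := hFf k x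
    have h2 := abs_max_neg_min_le_right (Nat.cast_nonneg k) (f x)
    have h3 := hfa x 0
    rw [sub_zero] at h3
    have h4 : a * (1 / ((k : ℝ) + 1)) ≤ a :=
      mul_le_of_le_one_right ha.le (div_le_one_of_le₀ (by linarith [k.cast_nonneg (α := ℝ)])
        (by positivity))
    have h5 := abs_sub_abs_le_abs_sub (F k x) (max (-(k : ℝ)) (min k (f x)))
    have h6 := abs_sub_abs_le_abs_sub (f x) (f 0)
    linarith
  · rw [tendsto_iff_dist_tendsto_zero]
    have hz : Tendsto (fun k : ℕ => a * (1 / ((k : ℝ) + 1))) atTop (𝓝 0) := by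
      simpa using tendsto_one_div_add_atTop_nhds_zero_nat.const_mul a
    refine squeeze_zero' (Eventually.of_forall fun _ => dist_nonneg) ?_ hz
    filter_upwards [eventually_ge_atTop ⌈|f x|⌉₊] with k hk
    have := hFf k x
    rwa [max_neg_min_eq_self (Nat.ceil_le.1 hk)] at this

end Limit

end PermInvariantConcentration

/-- If `f : ℝⁿ → ℝ` is permutation invariant, `b`-Lipschitz w.r.t. `‖·‖₂` and
`a`-Lipschitz w.r.t. `‖·‖_∞`, then
`P(|f(G) − E f(G)| > t) ≤ 4 exp(−c max{t²/b², (t/b)√(log(n b²/a²))})`. -/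
theorem statement1 :
    ∃ c > (0 : ℝ), ∀ (n : ℕ) (f : (Fin n → ℝ) → ℝ) (a b : ℝ),
      0 < a → 0 < b →
      (∀ (p : Equiv.Perm (Fin n)) (x : Fin n → ℝ), f (x ∘ p) = f x) →
      (∀ x y, |f x - f y| ≤ b * euclNorm (x - y)) →
      (∀ x y, |f x - f y| ≤ a * ‖x - y‖) →
      ∀ t > (0 : ℝ),
        stdGaussian n {x | t < |f x - ∫ y, f y ∂stdGaussian n|}
          ≤ ENNReal.ofReal
              (4 * Real.exp (-c * max (t ^ 2 / b ^ 2)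
                (t / b * Real.sqrt (Real.log (n * b ^ 2 / a ^ 2))))) := by
  exact ⟨1 / 5, by norm_num, fun n f a b ha hb hp hfb hfa t ht =>
    measure_lt_abs_sub_le_of_perm_invariant ha hb hp hfb hfa ht⟩
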